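/- Let (Γ_i)_{i∈I} and (Λ_j)_{j∈J} be families of infinite countable measurably freely indecomposable groups, with I = {1,…,n}, J = {1,…,m}, n, m ∈ ℕ* ∪ {∞}. Let α be a free p.m.p. action of the group free product *_{i∈I} Γ_i and β a free p.m.p. action of *_{j∈J} Λ_j on standard probability spaces, such that every restriction α|Γ_i and every restriction β|Λ_j is ergodic. If α and β are stably orbit equivalent, then n = m and there is a bijection θ : I → J such that for every i ∈ I the restrictions α|Γ_i and β|Λ_{θ(i)} are stably orbit equivalent. -/

import Mathlib

open MeasureTheory

/-- A countable Borel equivalence relation on `X`, defined on a Borel domain `dom`: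
it is Borel as a subset of `X × X`, is an equivalence relation on `dom`, and has
countable classes. -/
structure CBER (X : Type) [MeasurableSpace X] where
  dom : Set X
  dom_meas : MeasurableSet dom
  rel : X → X → Prop
  rel_meas : MeasurableSet {p : X × X | rel p.1 p.2}
  rel_dom : ∀ {x y : X}, rel x y → x ∈ dom ∧ y ∈ dom
  refl : ∀ x ∈ dom, rel x x
  symm : ∀ {x y : X}, rel x y → rel y x
  trans : ∀ {x y z : X}, rel x y → rel y z → rel x z
  countable_classes : ∀ x : X, {y | rel x y}.Countable

/-- The class of `x`. -/
def CBER.cls {X : Type} [MeasurableSpace X] (R : CBER X) (x : X) : Set X := {y | R.rel x y}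

/-- The `R`-saturation of a set `A`: the union of the `R`-classes meeting `A`. -/
def CBER.sat {X : Type} [MeasurableSpace X] (R : CBER X) (A : Set X) : Set X :=
  {y | ∃ x ∈ A, R.rel x y}

/-- A complete section: a Borel subset of the domain meeting every class. -/
def CBER.IsCompleteSection {X : Type} [MeasurableSpace X] (R : CBER X) (A : Set X) : Prop :=
  MeasurableSet A ∧ A ⊆ R.dom ∧ ∀ x ∈ R.dom, ∃ y ∈ A, R.rel x y

/-- A smooth CBER: one admitting a Borel fundamental domain (a Borel set meeting
every class exactly once). -/
def CBER.Smooth {X : Type} [MeasurableSpace X] (R : CBER X) : Prop :=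
  ∃ D : Set X, MeasurableSet D ∧ D ⊆ R.dom ∧ ∀ x ∈ R.dom, ∃! y, y ∈ D ∧ R.rel x y

/-- Smoothness of the restriction `R|A`. -/
def CBER.SmoothOn {X : Type} [MeasurableSpace X] (R : CBER X) (A : Set X) : Prop :=
  ∃ D : Set X, MeasurableSet D ∧ D ⊆ A ∧ ∀ x ∈ R.dom ∩ A, ∃! y, y ∈ D ∧ R.rel x y

/-- All classes are finite. -/
def CBER.FiniteClasses {X : Type} [MeasurableSpace X] (R : CBER X) : Prop :=
  ∀ x ∈ R.dom, (R.cls x).Finite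

/-- Aperiodic: all classes are infinite (on the domain). -/
def CBER.Aperiodic {X : Type} [MeasurableSpace X] (R : CBER X) : Prop :=
  ∀ x ∈ R.dom, (R.cls x).Infinite

/-- Trivial: all classes are singletons. -/
def CBER.TrivialClasses {X : Type} [MeasurableSpace X] (R : CBER X) : Prop :=
  ∀ x y, R.rel x y → x = y

/-- The restriction `R|U` of `R` to a Borel set `U`. -/
def CBER.restrict {X : Type} [MeasurableSpace X] (R : CBER X) (U : Set X)
    (hU : MeasurableSet U) : CBER X where
  dom := R.dom ∩ U
  dom_meas := R.dom_meas.inter hU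
  rel x y := R.rel x y ∧ x ∈ U ∧ y ∈ U
  rel_meas := by
    have h : {p : X × X | R.rel p.1 p.2 ∧ p.1 ∈ U ∧ p.2 ∈ U} =
        {p : X × X | R.rel p.1 p.2} ∩ (Prod.fst ⁻¹' U ∩ Prod.snd ⁻¹' U) := by
      ext p
      simp only [Set.mem_setOf_eq, Set.mem_inter_iff, Set.mem_preimage, and_assoc]
    rw [h]
    exact R.rel_meas.inter ((measurable_fst hU).inter (measurable_snd hU))
  rel_dom := fun h => ⟨⟨(R.rel_dom h.1).1, h.2.1⟩, ⟨(R.rel_dom h.1).2, h.2.2⟩⟩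
  refl := fun x hx => ⟨R.refl x hx.1, hx.2, hx.2⟩
  symm := fun h => ⟨R.symm h.1, h.2.2, h.2.1⟩
  trans := fun h h' => ⟨R.trans h.1 h'.1, h.2.1, h'.2.2⟩
  countable_classes := fun x =>
    Set.Countable.mono (fun y hy => hy.1) (R.countable_classes x)

/-- `S` is a subrelation of `R`. -/
def CBER.IsSubrelOf {X : Type} [MeasurableSpace X] (S R : CBER X) : Prop :=
  S.dom ⊆ R.dom ∧ ∀ x y, S.rel x y → R.rel x y

/-- A partial Borel isomorphism between Borel subsets `src` and `tgt` of `X`. -/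
structure PBI (X : Type) [MeasurableSpace X] where
  src : Set X
  tgt : Set X
  src_meas : MeasurableSet src
  tgt_meas : MeasurableSet tgt
  toFun : X → X
  invFun : X → X
  meas_toFun : Measurable toFun
  meas_invFun : Measurable invFun
  mapsTo : Set.MapsTo toFun src tgt
  mapsTo_inv : Set.MapsTo invFun tgt src
  left_inv : ∀ x ∈ src, invFun (toFun x) = x
  right_inv : ∀ y ∈ tgt, toFun (invFun y) = y

/-- Membership in the full pseudogroup `[[R]]`: a partial Borel isomorphism whose
graph is contained in `R`. -/
def CBER.InPseudogroup {X : Type} [MeasurableSpace X] (R : CBER X) (φ : PBI X) : Prop :=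
  φ.src ⊆ R.dom ∧ ∀ x ∈ φ.src, R.rel x (φ.toFun x)

/-- Two subrelations `S₁`, `S₂` of `R` are inner conjugate in `R` if some element of the
full pseudogroup of `R` with domain `D(S₂)` and target `D(S₁)` conjugates one to the other. -/
def InnerConjugate {X : Type} [MeasurableSpace X] (R S₁ S₂ : CBER X) : Prop :=
  ∃ φ : PBI X, R.InPseudogroup φ ∧ φ.src = S₂.dom ∧ φ.tgt = S₁.dom ∧
    ∀ x ∈ φ.src, ∀ y ∈ φ.src, (S₂.rel x y ↔ S₁.rel (φ.toFun x) (φ.toFun y))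

/-- `R` preserves the measure `μ`: every element of its full pseudogroup preserves `μ`. -/
def CBER.IsPMP {X : Type} [MeasurableSpace X] (R : CBER X) (μ : Measure X) : Prop :=
  ∀ φ : PBI X, R.InPseudogroup φ → ∀ A : Set X, A ⊆ φ.src → MeasurableSet A →
    μ (φ.toFun '' A) = μ A

/-- Free independence of a family of equivalence relations: any cycle alternating
nontrivially among the factors must have two consecutive steps in the same factor. -/
def FreelyIndep {X : Type} [MeasurableSpace X] {ι : Type} (Rf : ι → CBER X) : Prop :=
  ∀ (n : ℕ) (x : ℕ → X) (i : ℕ → ι), 2 ≤ n → x n = x 0 →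
    (∀ j < n, x j ≠ x (j + 1)) → (∀ j < n, (Rf (i j)).rel (x j) (x (j + 1))) →
    ∃ j, j + 1 < n ∧ i j = i (j + 1)

/-- `R` is the free product of the family `Rf`: the family is freely independent and `R`
is the smallest equivalence relation on the union of the domains containing every `Rf i`. -/
def IsFreeProduct {X : Type} [MeasurableSpace X] {ι : Type} (R : CBER X)
    (Rf : ι → CBER X) : Prop :=
  FreelyIndep Rf ∧ R.dom = (⋃ i, (Rf i).dom) ∧
    ∀ x y, R.rel x y ↔
      (x ∈ R.dom ∧ Relation.EqvGen (fun a b => ∃ i, (Rf i).rel a b) x y)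

/-- The partition `U = ⊔ⱼ Uⱼ` trivializes the free product decomposition `R = *ⱼ Rf j`:
`U` is a complete section for `R`, the partition is `R|U`-invariant, and
`R|Uⱼ = (Rf j)|Uⱼ` for every `j`. -/
def Trivializes {X : Type} [MeasurableSpace X] {ι : Type}
    (R : CBER X) (Rf : ι → CBER X) (U : ι → Set X) : Prop :=
  (∀ j, MeasurableSet (U j)) ∧ (∀ j, U j ⊆ R.dom) ∧
  Pairwise (Function.onFun Disjoint U) ∧
  (∀ x ∈ R.dom, ∃ y ∈ ⋃ j, U j, R.rel x y) ∧
  (∀ i j : ι, ∀ x ∈ U i, ∀ y ∈ U j, R.rel x y → i = j) ∧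
  (∀ j, ∀ x ∈ U j, ∀ y ∈ U j, (R.rel x y ↔ (Rf j).rel x y))

/-- A free product decomposition is inessential if it admits a trivialization. -/
def Inessential {X : Type} [MeasurableSpace X] {ι : Type}
    (R : CBER X) (Rf : ι → CBER X) : Prop :=
  ∃ U : ι → Set X, Trivializes R Rf U

/-- Freely indecomposable (Borel context): every free product decomposition is inessential. -/
def FreelyIndecomposable {X : Type} [MeasurableSpace X] (R : CBER X) : Prop :=
  ∀ (ι : Type) (_ : Countable ι) (Rf : ι → CBER X), IsFreeProduct R Rf → Inessential R Rf

/-- Inessential decomposition in the measured context: a trivialization up to `μ`-null sets. -/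
def InessentialMod {X : Type} [MeasurableSpace X] (μ : Measure X) {ι : Type}
    (R : CBER X) (Rf : ι → CBER X) : Prop :=
  ∃ (U : ι → Set X) (C : Set X),
    (∀ j, MeasurableSet (U j)) ∧ (∀ j, U j ⊆ R.dom) ∧
    Pairwise (Function.onFun Disjoint U) ∧
    MeasurableSet C ∧ μ Cᶜ = 0 ∧
    (∀ x ∈ R.dom ∩ C, ∃ y ∈ ⋃ j, U j, R.rel x y) ∧
    (∀ i j : ι, ∀ x ∈ U i ∩ C, ∀ y ∈ U j ∩ C, R.rel x y → i = j) ∧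
    (∀ j, ∀ x ∈ U j ∩ C, ∀ y ∈ U j ∩ C, (R.rel x y ↔ (Rf j).rel x y))

/-- Freely indecomposable (measured context): every free product decomposition is
inessential up to `μ`-null sets. -/
def FreelyIndecomposableMod {X : Type} [MeasurableSpace X] (μ : Measure X)
    (R : CBER X) : Prop :=
  ∀ (ι : Type) (_ : Countable ι) (Rf : ι → CBER X), IsFreeProduct R Rf →
    InessentialMod μ R Rf

/-- One step of a word in a graphing: apply `φ` (if `e = true`) or `φ⁻¹` (if `e = false`). -/
def PBIStep {X : Type} [MeasurableSpace X] (φ : PBI X) : Bool → X → X → Prop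
  | true, a, b => a ∈ φ.src ∧ φ.toFun a = b
  | false, a, b => a ∈ φ.tgt ∧ φ.invFun a = b

/-- A treeing: any cyclic word in the generators and their inverses admits a reduction. -/
def IsTreeing {X : Type} [MeasurableSpace X] {ι : Type} (Φ : ι → PBI X) : Prop :=
  ∀ (n : ℕ) (i : ℕ → ι) (ε : ℕ → Bool) (x : ℕ → X),
    0 < n → x n = x 0 → (∀ j < n, PBIStep (Φ (i j)) (ε j) (x j) (x (j + 1))) →
    ∃ j, j + 1 < n ∧ i j = i (j + 1) ∧ ε j ≠ ε (j + 1)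

/-- The graphing `Φ` generates `R`: `R` is the smallest equivalence relation on the union of
the sources and targets containing the graphs of the `Φ i`. -/
def GeneratesCBER {X : Type} [MeasurableSpace X] {ι : Type} (Φ : ι → PBI X)
    (R : CBER X) : Prop :=
  R.dom = (⋃ i, ((Φ i).src ∪ (Φ i).tgt)) ∧ (∀ i, R.InPseudogroup (Φ i)) ∧
    ∀ x y, R.rel x y ↔ (x ∈ R.dom ∧
      Relation.EqvGen (fun a b => ∃ i, a ∈ (Φ i).src ∧ (Φ i).toFun a = b) x y)

/-- Treeable: generated by some (countable) treeing. -/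
def CBER.Treeable {X : Type} [MeasurableSpace X] (R : CBER X) : Prop :=
  ∃ Φ : ℕ → PBI X, IsTreeing Φ ∧ GeneratesCBER Φ R

/-- Hyperfinite: increasing union of finite Borel subrelations. -/
def CBER.Hyperfinite {X : Type} [MeasurableSpace X] (R : CBER X) : Prop :=
  ∃ S : ℕ → CBER X, (∀ n, (S n).IsSubrelOf R) ∧ (∀ n, (S n).FiniteClasses) ∧
    (∀ n, (S n).dom = R.dom) ∧ (∀ n, ∀ x y, (S n).rel x y → (S (n + 1)).rel x y) ∧
    ∀ x y, R.rel x y → ∃ n, (S n).rel x y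

/-- Ergodicity of a measured CBER: every invariant Borel set is null or conull. -/
def ErgodicCBER {X : Type} [MeasurableSpace X] (R : CBER X) (μ : Measure X) : Prop :=
  ∀ A : Set X, MeasurableSet A → (∀ x ∈ A, ∀ y, R.rel x y → y ∈ A) →
    μ A = 0 ∨ μ Aᶜ = 0

/-- A stable orbit equivalence between measured CBERs: a Borel isomorphism between
complete sections (mod null sets), sending the normalized measure to the normalized
measure, and preserving the relations a.e. -/
structure SOEquiv {X Y : Type} [MeasurableSpace X] [MeasurableSpace Y]
    (R : CBER X) (μ : Measure X) (S : CBER Y) (ν : Measure Y) where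
  A : Set X
  B : Set Y
  toFun : X → Y
  invFun : Y → X
  measA : MeasurableSet A
  measB : MeasurableSet B
  A_sub : A ⊆ R.dom
  B_sub : B ⊆ S.dom
  A_pos : 0 < μ A
  B_pos : 0 < ν B
  A_section : ∀ᵐ x ∂μ, x ∈ R.dom → ∃ y ∈ A, R.rel x y
  B_section : ∀ᵐ y ∂ν, y ∈ S.dom → ∃ z ∈ B, S.rel y z
  meas_toFun : Measurable toFun
  meas_invFun : Measurable invFun
  mapsTo : Set.MapsTo toFun A B
  mapsTo_inv : Set.MapsTo invFun B A
  left_inv : ∀ x ∈ A, invFun (toFun x) = x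
  right_inv : ∀ y ∈ B, toFun (invFun y) = y
  measure_eq : ∀ E : Set X, E ⊆ A → MeasurableSet E →
    (μ A)⁻¹ * μ E = (ν B)⁻¹ * ν (toFun '' E)
  rel_iff : ∃ C : Set X, MeasurableSet C ∧ μ (A \ C) = 0 ∧
    ∀ x ∈ A ∩ C, ∀ y ∈ A ∩ C, (R.rel x y ↔ S.rel (toFun x) (toFun y))

/-- Stable orbit equivalence. -/
def SOE {X Y : Type} [MeasurableSpace X] [MeasurableSpace Y]
    (R : CBER X) (μ : Measure X) (S : CBER Y) (ν : Measure Y) : Prop :=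
  Nonempty (SOEquiv R μ S ν)

/-- Orbit equivalence: a stable orbit equivalence where one can take the complete
sections to be the full spaces. -/
def OE {X Y : Type} [MeasurableSpace X] [MeasurableSpace Y]
    (R : CBER X) (μ : Measure X) (S : CBER Y) (ν : Measure Y) : Prop :=
  ∃ E : SOEquiv R μ S ν, E.A = Set.univ ∧ E.B = Set.univ

/-- A probability measure preserving action of a group `G` on a measured space. -/
structure PMPAction (G : Type) [Group G] (X : Type) [MeasurableSpace X]
    (μ : Measure X) where
  act : G → X → X
  act_one : ∀ x, act 1 x = x
  act_mul : ∀ g h x, act (g * h) x = act g (act h x)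
  measurePreserving : ∀ g, MeasurePreserving (act g) μ μ

/-- Essential freeness: a.e. point has trivial stabilizer. -/
def PMPAction.IsFree {G X : Type} [Group G] [MeasurableSpace X] {μ : Measure X}
    (α : PMPAction G X μ) : Prop :=
  ∀ᵐ x ∂μ, ∀ g : G, α.act g x = x → g = 1

/-- `R` is the orbit equivalence relation of the action `α` restricted to the subgroup `H`. -/
def IsOrbitRel {G X : Type} [Group G] [MeasurableSpace X] {μ : Measure X}
    (α : PMPAction G X μ) (H : Subgroup G) (R : CBER X) : Prop :=
  R.dom = Set.univ ∧ ∀ x y, (R.rel x y ↔ ∃ g ∈ H, α.act g x = y)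

/-- A countable group is measurably freely indecomposable (MFI) if the orbit equivalence
relation of every free p.m.p. action of it on a standard probability space is freely
indecomposable. -/
def MFI (G : Type) [Group G] [Countable G] : Prop :=
  ∀ (X : Type) [MeasurableSpace X] [StandardBorelSpace X]
    (μ : Measure X) [IsProbabilityMeasure μ]
    (α : PMPAction G X μ) (R : CBER X),
    α.IsFree → IsOrbitRel α ⊤ R → FreelyIndecomposableMod μ R

/-- `G` is the internal free product of the family of subgroups `H`. -/
def IsFreeProductOf (G : Type) [Group G] {ι : Type} (H : ι → Subgroup G) : Prop :=
  Function.Bijective (Monoid.CoprodI.lift fun i => (H i).subtype)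

/-- A Borel fundamental domain for an action, of the coupling kind: meets a.e. orbit,
and meets each orbit at most once mod null. -/
def IsFundamentalDomainFor {G : Type} [Group G] {Ω : Type} [MeasurableSpace Ω]
    (ν : Measure Ω) (a : G → Ω → Ω) (D : Set Ω) : Prop :=
  MeasurableSet D ∧ (∀ᵐ x ∂ν, ∃ g : G, a g x ∈ D) ∧
    ∀ g : G, g ≠ 1 → ν (D ∩ a g ⁻¹' D) = 0

/-- A measure equivalence coupling between `G` and `H`: a standard σ-finite measure space
with commuting measure-preserving essentially free actions of `G` and `H`, each admitting
a Borel fundamental domain of finite positive measure. -/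
structure MECoupling (G : Type) [Group G] (H : Type) [Group H] where
  (Ω : Type)
  [mΩ : MeasurableSpace Ω]
  [sbΩ : StandardBorelSpace Ω]
  (ν : Measure Ω)
  sigmaFinite : SigmaFinite ν
  aG : G → Ω → Ω
  aH : H → Ω → Ω
  DG : Set Ω
  DH : Set Ω
  aG_one : ∀ x, aG 1 x = x
  aG_mul : ∀ g g' x, aG (g * g') x = aG g (aG g' x)
  aH_one : ∀ x, aH 1 x = x
  aH_mul : ∀ h h' x, aH (h * h') x = aH h (aH h' x)
  comm : ∀ g h x, aG g (aH h x) = aH h (aG g x)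
  mp_aG : ∀ g, MeasurePreserving (aG g) ν ν
  mp_aH : ∀ h, MeasurePreserving (aH h) ν ν
  free_aG : ∀ᵐ x ∂ν, ∀ g, aG g x = x → g = 1
  free_aH : ∀ᵐ x ∂ν, ∀ h, aH h x = x → h = 1
  fund_DG : IsFundamentalDomainFor ν aG DG
  fund_DH : IsFundamentalDomainFor ν aH DH
  DG_pos : 0 < ν DG
  DG_fin : ν DG < ⊤
  DH_pos : 0 < ν DH
  DH_fin : ν DH < ⊤

/-- The generalized index (compression constant) of a measure equivalence coupling. -/
noncomputable def MECoupling.index {G : Type} [Group G] {H : Type} [Group H]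
    (c : MECoupling G H) : ENNReal :=
  c.ν c.DH / c.ν c.DG

/-- Measure equivalence of countable groups. -/
def MeasureEquivalent (G : Type) [Group G] (H : Type) [Group H] : Prop :=
  Nonempty (MECoupling G H)

/-- Measure equivalence with a prescribed generalized index. -/
def MEwithIndex (G : Type) [Group G] (H : Type) [Group H] (κ : ENNReal) : Prop :=
  ∃ c : MECoupling G H, c.index = κ


/-- Normal forms for the internal free product of the subgroups `Λ j`: `T j` is the set of elements
whose reduced word does not begin with a letter of `Λ j`, and `key` lists the codes of the letters
of the reduced word. -/
structure FreeNormalForm {H J : Type} [Group H] (Λ : J → Subgroup H) where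
  T : J → Set H
  key : H → List ℕ
  code : J → H → ℕ
  key_inj : Function.Injective key
  key_one : key 1 = []
  one_mem : ∀ j, 1 ∈ T j
  exists_tail : ∀ j h, ∃ l ∈ Λ j, ∃ a ∈ T j, h = l * a
  tail_unique : ∀ {j a l}, a ∈ T j → l ∈ Λ j → l * a ∈ T j → l = 1
  cons_mem : ∀ {i j l a}, i ≠ j → l ∈ Λ i → l ≠ 1 → a ∈ T i → l * a ∈ T j
  key_cons : ∀ {i l a}, l ∈ Λ i → l ≠ 1 → a ∈ T i → key (l * a) = code i l :: key a
  exists_cons : ∀ h, h ≠ 1 → ∃ i l a, l ∈ Λ i ∧ l ≠ 1 ∧ a ∈ T i ∧ h = l * a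

open Monoid.CoprodI in
theorem IsFreeProductOf.nonempty_normalForm {H J : Type} [Group H] [Countable H] [Countable J]
    {Λ : J → Subgroup H} (hH : IsFreeProductOf H Λ) : Nonempty (FreeNormalForm Λ) := by
  classical
  obtain ⟨cd, hcd⟩ := Countable.exists_injective_nat (Σ j, Λ j)
  let pr : Word (fun j => Λ j) → H := fun w => lift (fun i => (Λ i).subtype) w.prod
  have pr_bij : Function.Bijective pr := hH.comp (Word.equiv (M := fun j => Λ j)).symm.bijective
  have pr_empty : pr Word.empty = 1 := by simp [pr]
  have pr_cons : ∀ (i) (m : Λ i) w h1 h2, pr (Word.cons m w h1 h2) = m * pr w := by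
    intro i m w h1 h2
    simp [pr]
  have pr_rcons : ∀ (i) (p : Word.Pair (fun j => Λ j) i),
      pr (Word.rcons p) = p.head * pr p.tail := by
    intro i p
    simp [pr]
  let e : Word (fun j => Λ j) ≃ H := Equiv.ofBijective pr pr_bij
  have e_symm : ∀ w, e.symm (pr w) = w := fun w => e.symm_apply_apply w
  refine ⟨{
    T := fun j => {h | (e.symm h).fstIdx ≠ some j}
    key := fun h => (e.symm h).toList.map cd
    code := fun j l => if hl : l ∈ Λ j then cd ⟨j, l, hl⟩ else 0
    key_inj := ?_
    key_one := ?_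
    one_mem := ?_
    exists_tail := ?_
    tail_unique := ?_
    cons_mem := ?_
    key_cons := ?_
    exists_cons := ?_ }⟩
  · intro a b hab
    exact e.symm.injective (Word.ext (List.map_injective_iff.2 hcd hab))
  · simp [← pr_empty, e_symm, Word.empty]
  · intro j
    simp [← pr_empty, e_symm, Word.empty, Word.fstIdx]
  · intro j h
    obtain ⟨w, rfl⟩ := pr_bij.2 h
    obtain ⟨p, rfl⟩ := (Word.equivPair j).symm.surjective w
    refine ⟨p.head, p.head.2, pr p.tail, ?_, ?_⟩
    · simpa [e_symm] using p.fstIdx_ne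
    · rw [Word.equivPair_symm, pr_rcons]
  · intro j a l ha hl hla
    obtain ⟨w, rfl⟩ := pr_bij.2 a
    have hw : w.fstIdx ≠ some j := by simpa [e_symm] using ha
    by_contra hne
    have hne' : (⟨l, hl⟩ : Λ j) ≠ 1 := fun h => hne (congrArg Subtype.val h)
    apply hla
    rw [show l * pr w = pr (Word.cons ⟨l, hl⟩ w hw hne') from
      (pr_cons j ⟨l, hl⟩ w hw hne').symm, e_symm]
    simp
  · intro i j l a hij hl hne ha
    obtain ⟨w, rfl⟩ := pr_bij.2 a
    have hw : w.fstIdx ≠ some i := by simpa [e_symm] using ha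
    have hne' : (⟨l, hl⟩ : Λ i) ≠ 1 := fun h => hne (congrArg Subtype.val h)
    rw [show l * pr w = pr (Word.cons ⟨l, hl⟩ w hw hne') from (pr_cons i ⟨l, hl⟩ w hw hne').symm]
    simp [e_symm, hij]
  · intro i l a hl hne ha
    obtain ⟨w, rfl⟩ := pr_bij.2 a
    have hw : w.fstIdx ≠ some i := by simpa [e_symm] using ha
    have hne' : (⟨l, hl⟩ : Λ i) ≠ 1 := fun h => hne (congrArg Subtype.val h)
    rw [show l * pr w = pr (Word.cons ⟨l, hl⟩ w hw hne') from (pr_cons i ⟨l, hl⟩ w hw hne').symm]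
    simp [e_symm, hl]
  · intro h hne
    obtain ⟨w, rfl⟩ := pr_bij.2 h
    induction w using Word.consRecOn with
    | empty => exact absurd pr_empty hne
    | cons i m w h1 h2 _ =>
      refine ⟨i, m, pr w, m.2, fun h => h2 (Subtype.ext h), ?_, pr_cons _ _ _ _ _⟩
      simpa [e_symm] using h1

namespace FreeNormalForm

variable {H J : Type} [Group H] {Λ : J → Subgroup H} (nf : FreeNormalForm Λ)

/-- The short-lexicographic well-order on `H` induced by reduced words. -/
def lt (a b : H) : Prop := List.Shortlex (· < ·) (nf.key a) (nf.key b)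

theorem lt_wf : WellFounded nf.lt := InvImage.wf nf.key (List.Shortlex.wf Nat.lt_wfRel.wf)

theorem lt_trichotomy (a b : H) : nf.lt a b ∨ a = b ∨ nf.lt b a := by
  by_contra! h
  exact h.2.1 (nf.key_inj
    (Std.Trichotomous.trichotomous (r := List.Shortlex (· < ·)) _ _ h.1 h.2.2))

theorem one_lt {a : H} (ha : a ≠ 1) : nf.lt 1 a := by
  have h := List.shortlex_nil_or_eq_nil (r := (· < ·)) (nf.key a)
  rw [← nf.key_one] at h
  exact h.resolve_right fun h => ha (nf.key_inj h)

theorem cons_induction {P : H → Prop} (one : P 1)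
    (cons : ∀ i l a, l ∈ Λ i → l ≠ 1 → a ∈ nf.T i → P a → P (l * a)) (h : H) : P h := by
  induction hn : (nf.key h).length using Nat.strong_induction_on generalizing h with
  | _ n ih =>
    by_cases h1 : h = 1
    · rwa [h1]
    · obtain ⟨i, l, a, hl, hl1, ha, rfl⟩ := nf.exists_cons h h1
      refine cons i l a hl hl1 ha (ih _ ?_ a rfl)
      rw [← hn, nf.key_cons hl hl1 ha]
      simp

theorem lt_cons_of_lt {i : J} {l a b : H} (hl : l ∈ Λ i) (hl1 : l ≠ 1) (ha : a ∈ nf.T i)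
    (hb : nf.lt b a) : nf.lt (l * b) (l * a) := by
  obtain ⟨m, hm, c, hc, rfl⟩ := nf.exists_tail i b
  unfold lt at *
  rw [nf.key_cons hl hl1 ha]
  by_cases hm1 : m = 1
  · subst hm1
    rw [one_mul] at hb ⊢
    rw [nf.key_cons hl hl1 hc]
    exact List.shortlex_cons_iff.2 hb
  · rw [nf.key_cons hm hm1 hc] at hb
    have hlen : (nf.key c).length + 1 ≤ (nf.key a).length := by
      rcases List.shortlex_def.1 hb with h | h
      · simpa using h.le
      · simpa using h.1.le
    apply List.Shortlex.of_length_lt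
    rw [← mul_assoc]
    by_cases hlm : l * m = 1
    · simp only [hlm, one_mul, List.length_cons]
      omega
    · rw [nf.key_cons (mul_mem hl hm) hlm hc]
      simp only [List.length_cons]
      omega

/-- Right multiplication by a letter does not change the first letter of a reduced word, unless
the word is empty or consists of one letter of the same factor. -/
theorem mul_mem_T {a : H} : ∀ {j i : J} {l : H}, a ∈ nf.T j → l ∈ Λ i → ¬(a = 1 ∧ i = j) →
    a * l ∈ nf.T j := by
  have letter : ∀ {i j : J} {l : H}, i ≠ j → l ∈ Λ i → l ∈ nf.T j := by
    intro i j l hij hl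
    by_cases h1 : l = 1
    · exact h1 ▸ nf.one_mem j
    · simpa using nf.cons_mem hij hl h1 (nf.one_mem i)
  induction a using nf.cons_induction with
  | one =>
    intro j i l _ hl hne
    rw [one_mul]
    exact letter (by simpa using hne) hl
  | cons k m a hm hm1 ha ih =>
    intro j i l hma hl _
    have hkj : k ≠ j := by
      rintro rfl
      exact hm1 (nf.tail_unique ha hm hma)
    by_cases hc : a = 1 ∧ i = k
    · obtain ⟨rfl, rfl⟩ := hc
      rw [mul_one]
      exact letter hkj (mul_mem hm hl)
    · rw [mul_assoc]
      exact nf.cons_mem hkj hm hm1 (ih ha hl hc)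

/-- Free factors are malnormal and pairwise not conjugate. -/
theorem malnormal (nf : FreeNormalForm Λ) {i j : J} {u k : H} (hk : k ∈ Λ j) (hk1 : k ≠ 1)
    (hu : u * k * u⁻¹ ∈ Λ i) :
    j = i ∧ u ∈ Λ j := by
  obtain ⟨l, hl, a, ha, hla⟩ := nf.exists_tail j u⁻¹
  obtain rfl : u = a⁻¹ * l⁻¹ := by rw [← inv_inv u, hla, mul_inv_rev]
  set k₁ := l⁻¹ * k * l with hk₁
  have hk₁m : k₁ ∈ Λ j := mul_mem (mul_mem (inv_mem hl) hk) hl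
  have hk₁1 : k₁ ≠ 1 := by
    intro h
    apply hk1
    have : k = l * k₁ * l⁻¹ := by rw [hk₁]; group
    rw [this, h]; group
  have hconj : a⁻¹ * l⁻¹ * k * (a⁻¹ * l⁻¹)⁻¹ = a⁻¹ * k₁ * a := by rw [hk₁]; group
  rw [hconj] at hu
  by_cases hc : a = 1 ∧ i = j
  · obtain ⟨rfl, rfl⟩ := hc
    exact ⟨rfl, by simpa using hl⟩
  · have h := nf.mul_mem_T ha hu hc
    rw [show a * (a⁻¹ * k₁ * a) = k₁ * a by group] at h
    exact absurd (nf.tail_unique ha hk₁m h) hk₁1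

end FreeNormalForm

namespace FreeNormalForm

variable {H J : Type} [Group H] {Λ : J → Subgroup H} (nf : FreeNormalForm Λ)

/-- `d` is the point of `D` nearest to `a * d` for the short-lexicographic order. -/
def IsNearest (D : Set H) (a d : H) : Prop := ∀ d' ∈ D, ∀ a', nf.lt a' a → a' * d' ≠ a * d

variable {nf} {D : Set H}

theorem IsNearest.of_cons {i : J} {l a d : H} (hl : l ∈ Λ i) (hl1 : l ≠ 1) (ha : a ∈ nf.T i)
    (h : nf.IsNearest D (l * a) d) : nf.IsNearest D a d := by
  intro d' hd' a' ha' he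
  refine h d' hd' (l * a') (nf.lt_cons_of_lt hl hl1 ha ha') ?_
  rw [mul_assoc, he, mul_assoc]

theorem IsNearest.unique {a d a' d' : H} (hd : d ∈ D) (hd' : d' ∈ D) (h : nf.IsNearest D a d)
    (h' : nf.IsNearest D a' d') (he : a * d = a' * d') : d = d' := by
  rcases nf.lt_trichotomy a a' with hlt | rfl | hlt
  · exact absurd he (h' d hd a hlt)
  · exact mul_left_cancel he
  · exact absurd he.symm (h d' hd' a' hlt)

theorem exists_isNearest (nf : FreeNormalForm Λ) (hD : D.Nonempty) (y : H) :
    ∃ a d, d ∈ D ∧ a * d = y ∧ nf.IsNearest D a d := by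
  obtain ⟨d₀, hd₀⟩ := hD
  obtain ⟨a, ⟨d, hd, hy⟩, hmin⟩ := nf.lt_wf.has_min {a | ∃ d ∈ D, a * d = y}
    ⟨y * d₀⁻¹, d₀, hd₀, by group⟩
  exact ⟨a, d, hd, hy, fun d' hd' a' hlt he => hmin a' ⟨d', hd', he.trans hy⟩ hlt⟩

/-- For every coset `Λ j * b`, a nonempty set `D` retracts onto the set of points of `D` nearest to
points of `Λ j * b`, in such a way that the analogous sets for the other cosets are collapsed. -/
theorem exists_coset_retraction (nf : FreeNormalForm Λ) (hD : D.Nonempty) (j : J) (b : H) :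
    ∃ r : H → H,
      (∀ a d, d ∈ D → nf.IsNearest D a d → a * d * b⁻¹ ∈ Λ j → r d = d) ∧
      (∀ j' b' a d a' d', d ∈ D → d' ∈ D → nf.IsNearest D a d → nf.IsNearest D a' d' →
        a * d * b'⁻¹ ∈ Λ j' → a' * d' * b'⁻¹ ∈ Λ j' → ¬(j' = j ∧ b' * b⁻¹ ∈ Λ j) →
        r d = r d') := by
  choose q p hp hpy hnear using nf.exists_isNearest hD
  have hp_eq : ∀ {a d}, d ∈ D → nf.IsNearest D a d → p (a * d) = d := fun {a d} hd h =>
    (hnear (a * d)).unique (hp _) hd h (hpy _)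
  have hgate : ∀ z : H, ∃ g : H, g * z⁻¹ ∈ nf.T j ∧ g * b⁻¹ ∈ Λ j := by
    intro z
    obtain ⟨l, hl, a, ha, he⟩ := nf.exists_tail j (b * z⁻¹)
    refine ⟨a * z, by simpa using ha, ?_⟩
    have : a * z * b⁻¹ = l⁻¹ := by
      have h2 : a = l⁻¹ * (b * z⁻¹) := by rw [he]; group
      rw [h2]; group
    exact this ▸ inv_mem hl
  choose g hgT hgb using hgate
  have hg_eq : ∀ {z y}, y * z⁻¹ ∈ nf.T j → y * b⁻¹ ∈ Λ j → g z = y := by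
    intro z y hy hyb
    have h1 : g z * y⁻¹ ∈ Λ j := by
      have := mul_mem (hgb z) (inv_mem hyb)
      simpa [mul_assoc] using this
    have h2 := nf.tail_unique hy h1 (by simpa [mul_assoc] using hgT z)
    exact mul_inv_eq_one.1 h2
  have hg_self : ∀ {y}, y * b⁻¹ ∈ Λ j → g y = y := fun {y} hy =>
    hg_eq (by simpa using nf.one_mem j) hy
  have hg_const : ∀ {i y z}, y * z⁻¹ ∈ Λ i → ¬(i = j ∧ z * b⁻¹ ∈ Λ j) → g y = g z := by
    intro i y z hyz hne
    refine hg_eq ?_ (hgb z)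
    have := nf.mul_mem_T (hgT z) (inv_mem hyz) (fun hc => hne ⟨hc.2, ?_⟩)
    · simpa [mul_assoc] using this
    · have := hgb z
      rwa [mul_inv_eq_one.1 hc.1] at this
  have hcell : ∀ a {d}, d ∈ D → nf.IsNearest D a d → p (g (a * d)) = p (g d) := by
    intro a
    induction a using nf.cons_induction with
    | one => simp
    | cons i l a hl hl1 ha ih =>
      intro d hd hn
      have hn' := hn.of_cons hl hl1 ha
      rw [← ih hd hn']
      by_cases hc : i = j ∧ a * d * b⁻¹ ∈ Λ j
      · obtain ⟨rfl, hc⟩ := hc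
        rw [hg_self hc, hp_eq hd hn', hg_self, hp_eq hd hn]
        have := mul_mem hl hc
        simpa [mul_assoc] using this
      · rw [hg_const (i := i) (z := a * d) ?_ hc]
        simpa [mul_assoc] using hl
  refine ⟨fun d => p (g d), ?_, ?_⟩
  · intro a d hd hn hb
    simp only
    rw [← hcell a hd hn, hg_self hb, hp_eq hd hn]
  · intro j' b' a d a' d' hd hd' hn hn' hb hb' hne
    simp only
    rw [← hcell a hd hn, ← hcell a' hd' hn']
    congr 1
    refine hg_const (i := j') ?_ ?_
    · have := mul_mem hb (inv_mem hb')
      simpa [mul_assoc] using this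
    · rintro ⟨rfl, hc⟩
      refine hne ⟨rfl, ?_⟩
      have := mul_mem (inv_mem hb') hc
      simpa [mul_assoc] using this

end FreeNormalForm

/-- Criterion for free independence: every class of every member of the family is a retract, up to
a map collapsing all other classes of members whose rank is not larger. -/
theorem freelyIndep_of_retractions {X : Type} [MeasurableSpace X] {ι : Type} {Rf : ι → CBER X}
    {S : CBER X} (hS : ∀ k x y, (Rf k).rel x y → S.rel x y) (rank : ι → ℕ)
    (h : ∀ k x y, (Rf k).rel x y → x ≠ y → ∃ (τ : Type) (r : X → τ),
      (∀ z z', (Rf k).rel x z → (Rf k).rel x z' → r z = r z' → z = z') ∧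
      ∀ k' z z', rank k' ≤ rank k → S.rel x z → (Rf k').rel z z' →
        ¬(k' = k ∧ (Rf k).rel x z) → r z = r z') :
    FreelyIndep Rf := by
  intro n
  induction n using Nat.strong_induction_on with
  | _ n ih =>
  intro x i hn hcyc hne hrel
  by_contra! hcon
  obtain ⟨p, hp, hmax⟩ : ∃ p < n, ∀ q < n, rank (i q) ≤ rank (i p) := by
    obtain ⟨p, hp, hmax⟩ := Finset.exists_max_image (Finset.range n) (fun q => rank (i q))
      ⟨0, by simp; omega⟩
    exact ⟨p, by simpa using hp, fun q hq => hmax q (by simpa using hq)⟩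
  have hSx : ∀ q ≤ n, S.rel (x 0) (x q) := by
    intro q
    induction q with
    | zero =>
      intro _
      have h0 := hS _ _ _ (hrel 0 (by omega))
      exact S.refl _ (S.rel_dom h0).1
    | succ q ihq =>
      intro hq
      exact S.trans (ihq (by omega)) (hS _ _ _ (hrel q (by omega)))
  have hSp : ∀ q ≤ n, S.rel (x p) (x q) := fun q hq => S.trans (S.symm (hSx p hp.le)) (hSx q hq)
  obtain ⟨τ, r, hinj, hconst⟩ := h _ _ _ (hrel p hp) (hne p hp)
  have hpp : (Rf (i p)).rel (x p) (x p) :=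
    (Rf (i p)).refl _ ((Rf (i p)).rel_dom (hrel p hp)).1
  have segment : ∀ s t, s ≤ t → t ≤ n →
      (∀ q, s ≤ q → q < t → ¬(i q = i p ∧ (Rf (i p)).rel (x p) (x q))) → r (x s) = r (x t) := by
    intro s t hst
    induction t, hst using Nat.le_induction with
    | base => intros; rfl
    | succ t hst iht =>
      intro ht hno
      rw [iht (by omega) fun q h1 h2 => hno q h1 (by omega)]
      exact hconst (i t) _ _ (hmax t (by omega)) (hSp t (by omega)) (hrel t (by omega))
        (hno t hst (by omega))
  have excursion : ∀ s t, s < t → t < n → (Rf (i p)).rel (x p) (x (s + 1)) → i s = i p →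
      (Rf (i p)).rel (x p) (x t) → i t = i p →
      (∀ q, s + 1 ≤ q → q < t → ¬(i q = i p ∧ (Rf (i p)).rel (x p) (x q))) → False := by
    intro s t hst ht hs his ht' hit hno
    have hlt : s + 1 ≠ t := by
      rintro rfl
      exact hcon s ht (his.trans hit.symm)
    have heq : x (s + 1) = x t := hinj _ _ hs ht' (segment _ _ (by omega) ht.le hno)
    have hlt2 : s + 2 ≠ t := by
      rintro rfl
      exact hne (s + 1) (by omega) heq
    obtain ⟨q, hq, hq'⟩ := ih (t - (s + 1)) (by omega) (fun q => x (s + 1 + q))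
      (fun q => i (s + 1 + q)) (by omega)
      (by simp only [add_zero]; rw [heq]; congr 1; omega)
      (fun q hq => hne (s + 1 + q) (by omega)) (fun q hq => hrel (s + 1 + q) (by omega))
    exact hcon (s + 1 + q) (by omega) hq'
  by_cases hafter : ∃ t, p < t ∧ t < n ∧ i t = i p ∧ (Rf (i p)).rel (x p) (x t)
  · classical
    have hf := Nat.find_spec hafter
    refine excursion p (Nat.find hafter) hf.1 hf.2.1 (hrel p hp) rfl hf.2.2.2 hf.2.2.1 ?_
    intro q h1 h2 h3
    exact Nat.find_min hafter h2 ⟨by omega, by omega, h3.1, h3.2⟩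
  by_cases hbefore : ∃ m, m < p ∧ i (p - 1 - m) = i p ∧ (Rf (i p)).rel (x p) (x (p - 1 - m))
  · classical
    have hf := Nat.find_spec hbefore
    set m := Nat.find hbefore with hm
    have hstep := hrel (p - 1 - m) (by omega)
    rw [hf.2.1] at hstep
    refine excursion (p - 1 - m) p (by omega) hp ((Rf (i p)).trans hf.2.2 hstep) hf.2.1 hpp rfl ?_
    intro q h1 h2 h3
    refine Nat.find_min hbefore (m := p - 1 - q) (by omega) ⟨by omega, ?_⟩
    rwa [show p - 1 - (p - 1 - q) = q by omega]
  · have h1 : r (x 0) = r (x p) := segment 0 p (by omega) hp.le fun q _ hq hc =>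
      hbefore ⟨p - 1 - q, by omega, by rwa [show p - 1 - (p - 1 - q) = q by omega]⟩
    have h2 : r (x (p + 1)) = r (x n) := segment (p + 1) n (by omega) le_rfl fun q hq hq' hc =>
      hafter ⟨q, by omega, hq', hc⟩
    rw [hcyc] at h2
    exact hne p hp (hinj _ _ hpp (hrel p hp) (h1.symm.trans h2.symm))

theorem CBER.measurable_rel {X Z : Type} [MeasurableSpace X] [MeasurableSpace Z] (R : CBER X)
    {f g : Z → X} (hf : Measurable f) (hg : Measurable g) :
    Measurable fun z => R.rel (f z) (g z) :=
  measurableSet_setOfPred.1 ((hf.prodMk hg) R.rel_meas)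

namespace PMPAction

variable {G X : Type} [Group G] [MeasurableSpace X] {μ : Measure X} (α : PMPAction G X μ)

@[simp]
theorem inv_act_act (g : G) (x : X) : α.act g⁻¹ (α.act g x) = x := by
  rw [← α.act_mul, inv_mul_cancel, α.act_one]

@[simp]
theorem act_inv_act (g : G) (x : X) : α.act g (α.act g⁻¹ x) = x := by
  rw [← α.act_mul, mul_inv_cancel, α.act_one]

theorem act_inj {g : G} {x y : X} : α.act g x = α.act g y ↔ x = y :=
  ⟨fun h => by rw [← α.inv_act_act g x, h, α.inv_act_act], fun h => h ▸ rfl⟩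

theorem eq_inv_act {g : G} {x y : X} (h : α.act g x = y) : x = α.act g⁻¹ y := by
  rw [← h, α.inv_act_act]

@[fun_prop]
theorem measurable_act (g : G) : Measurable (α.act g) := (α.measurePreserving g).measurable

/-- The equivalence relation whose nontrivial classes are the pairs `{x, g x}` with `x ∈ P`. -/
def edge [MeasurableEq X] (g : G) (P : Set X) (hP : MeasurableSet P)
    (hg : ∀ x ∈ P, α.act g x ∉ P) : CBER X where
  dom := P ∪ α.act g⁻¹ ⁻¹' P
  dom_meas := hP.union (α.measurable_act _ hP)
  rel x y := ∃ w ∈ P, (x = w ∨ x = α.act g w) ∧ (y = w ∨ y = α.act g w)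
  rel_meas := by
    have h : {p : X × X | ∃ w ∈ P, (p.1 = w ∨ p.1 = α.act g w) ∧ (p.2 = w ∨ p.2 = α.act g w)} =
        {p : X × X | p.1 ∈ P ∧ (p.2 = p.1 ∨ p.2 = α.act g p.1) ∨
          α.act g⁻¹ p.1 ∈ P ∧ (p.2 = α.act g⁻¹ p.1 ∨ p.2 = p.1)} := by
      ext p
      constructor
      · rintro ⟨w, hw, h1 | h1, h2⟩
        · exact Or.inl (by rw [h1]; exact ⟨hw, h2⟩)
        · exact Or.inr (by rw [h1, α.inv_act_act]; exact ⟨hw, h2⟩)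
      · rintro (⟨hw, h⟩ | ⟨hw, h⟩)
        · exact ⟨_, hw, Or.inl rfl, h⟩
        · exact ⟨_, hw, Or.inr (by simp), by simpa using h⟩
    rw [h, measurableSet_setOfPred]
    have e1 : Measurable fun p : X × X => p.1 ∈ P := measurable_mem.2 (measurable_fst hP)
    have e2 : Measurable fun p : X × X => α.act g⁻¹ p.1 ∈ P :=
      measurable_mem.2 ((α.measurable_act g⁻¹).comp measurable_fst hP)
    have e3 : Measurable fun p : X × X => p.2 = p.1 :=
      measurableSet_setOfPred.1 (measurableSet_eq_fun measurable_snd measurable_fst)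
    have e4 : Measurable fun p : X × X => p.2 = α.act g p.1 :=
      measurableSet_setOfPred.1 (measurableSet_eq_fun measurable_snd (by fun_prop))
    have e5 : Measurable fun p : X × X => p.2 = α.act g⁻¹ p.1 :=
      measurableSet_setOfPred.1 (measurableSet_eq_fun measurable_snd (by fun_prop))
    fun_prop
  rel_dom := by
    have : ∀ w ∈ P, ∀ x, (x = w ∨ x = α.act g w) → x ∈ P ∪ α.act g⁻¹ ⁻¹' P := by
      rintro w hw x (rfl | rfl)
      · exact Or.inl hw
      · exact Or.inr (by simpa using hw)
    rintro x y ⟨w, hw, h1, h2⟩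
    exact ⟨this w hw x h1, this w hw y h2⟩
  refl := by
    rintro x (hx | hx)
    · exact ⟨x, hx, Or.inl rfl, Or.inl rfl⟩
    · exact ⟨_, hx, Or.inr (by simp), Or.inr (by simp)⟩
  symm := fun ⟨w, hw, h1, h2⟩ => ⟨w, hw, h2, h1⟩
  trans := by
    rintro x y z ⟨w, hw, h1, h2⟩ ⟨w', hw', h3, h4⟩
    have : w = w' := by
      rcases h2 with rfl | rfl <;> rcases h3 with h3 | h3
      · exact h3
      · exact absurd (h3 ▸ hw) (hg w' hw')
      · exact absurd (h3 ▸ hw') (hg w hw)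
      · exact α.act_inj.1 h3
    subst this
    exact ⟨w, hw, h1, h4⟩
  countable_classes x := by
    refine Set.Countable.mono (s₂ := {x, α.act g x, α.act g⁻¹ x}) ?_ (by simp)
    rintro y ⟨w, hw, rfl | rfl, rfl | rfl⟩ <;> simp

end PMPAction

/-- A measurable map `F`, defined on a Borel section `sect` of the part `core` of a free action
of `Γ`, embedding the orbits of `Γ` in those of an action of a free product. -/
structure OrbitEmbedding {X Y Γ H J : Type} [MeasurableSpace X] [MeasurableSpace Y] [Group Γ]
    [Group H] {μ : Measure X} {ν : Measure Y} (α : PMPAction Γ X μ) (S : CBER X)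
    (β : PMPAction H Y ν) (Λ : J → Subgroup H) (RΛ : J → CBER Y) where
  nf : FreeNormalForm Λ
  core : Set X
  sect : Set X
  F : X → Y
  core_meas : MeasurableSet core
  sect_meas : MeasurableSet sect
  sect_sub : sect ⊆ core
  F_meas : Measurable F
  core_inv : ∀ γ, ∀ x ∈ core, α.act γ x ∈ core
  orbS : IsOrbitRel α ⊤ S
  orbΛ : ∀ j, IsOrbitRel β (Λ j) (RΛ j)
  hit : ∀ x ∈ core, ∃ γ, α.act γ x ∈ sect
  inj : Set.InjOn F sect
  equivar : ∀ x ∈ sect, ∀ y ∈ sect, S.rel x y → ∃ h, β.act h (F x) = F y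
  free : ∀ x ∈ sect, ∀ h, β.act h (F x) = F x → h = 1
  code : Γ → ℕ
  code_inj : Function.Injective code
  Q : ℕ → Set X
  Q_meas : ∀ n, MeasurableSet (Q n)
  Q_sep : ∀ x y, x ≠ y → ∃ n, x ∈ Q n ∧ y ∉ Q n

namespace OrbitEmbedding

variable {X Y Γ H J : Type} [MeasurableSpace X] [MeasurableSpace Y] [Group Γ]
    [Group H] {μ : Measure X} {ν : Measure Y} {α : PMPAction Γ X μ} {S : CBER X}
    {β : PMPAction H Y ν} {Λ : J → Subgroup H} {RΛ : J → CBER Y}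
    (E : OrbitEmbedding α S β Λ RΛ)

theorem mem_dom (E : OrbitEmbedding α S β Λ RΛ) (x : X) : x ∈ S.dom := by rw [E.orbS.1]; trivial

theorem rel_refl (E : OrbitEmbedding α S β Λ RΛ) (x : X) : S.rel x x := S.refl x (E.mem_dom x)

theorem rel_act (E : OrbitEmbedding α S β Λ RΛ) (γ : Γ) (x : X) : S.rel x (α.act γ x) :=
  (E.orbS.2 _ _).2 ⟨γ, trivial, rfl⟩

theorem exists_act (E : OrbitEmbedding α S β Λ RΛ) {x y : X} (h : S.rel x y) :
    ∃ γ, α.act γ x = y := by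
  obtain ⟨γ, -, h⟩ := (E.orbS.2 _ _).1 h
  exact ⟨γ, h⟩

theorem mem_core (E : OrbitEmbedding α S β Λ RΛ) {x y : X} (h : S.rel x y)
    (hx : x ∈ E.core) : y ∈ E.core := by
  obtain ⟨γ, rfl⟩ := E.exists_act h
  exact E.core_inv γ x hx

theorem relΛ_refl (E : OrbitEmbedding α S β Λ RΛ) (j : J) (y : Y) : (RΛ j).rel y y :=
  (RΛ j).refl y (by rw [(E.orbΛ j).1]; trivial)

theorem relΛ_iff (E : OrbitEmbedding α S β Λ RΛ) (j : J) (y y' : Y) :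
    (RΛ j).rel y y' ↔ ∃ h ∈ Λ j, β.act h y = y' :=
  (E.orbΛ j).2 y y'

theorem relΛ_act (E : OrbitEmbedding α S β Λ RΛ) {j : J} {l : H} (hl : l ∈ Λ j) (y : Y) :
    (RΛ j).rel y (β.act l y) :=
  (E.relΛ_iff j y _).2 ⟨l, hl, rfl⟩

theorem forall_rel (E : OrbitEmbedding α S β Λ RΛ) {p : X → Prop} (x : X) :
    (∀ z, S.rel x z → p z) ↔ ∀ γ, p (α.act γ x) :=
  ⟨fun h γ => h _ (E.rel_act γ x), fun h z hz => by
    obtain ⟨γ, rfl⟩ := E.exists_act hz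
    exact h γ⟩

/-- No point of the section in the orbit of `x` is closer than `x` to the point `a F(x)`. -/
def Near (a : H) (x : X) : Prop :=
  ∀ z, S.rel x z → z ∈ E.sect → ∀ a', E.nf.lt a' a → β.act a' (E.F z) ≠ β.act a (E.F x)

/-- No point of the section in the orbit of `x` is closer than `x` to the `Λ j`-orbit of
`a F(x)`. -/
def Min (j : J) (a : H) (x : X) : Prop :=
  ∀ z, S.rel x z → z ∈ E.sect → ∀ a', E.nf.lt a' a →
    ¬ (RΛ j).rel (β.act a (E.F x)) (β.act a' (E.F z))

variable {E} in
theorem Min.near {j : J} {a : H} {x : X} (h : E.Min j a x) : E.Near a x :=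
  fun z hz hz' a' ha' he => h z hz hz' a' ha' (he ▸ E.relΛ_refl j _)

theorem min_congr {j : J} {a : H} {x x' : X} (hS : S.rel x x')
    (hR : (RΛ j).rel (β.act a (E.F x)) (β.act a (E.F x'))) (h : E.Min j a x) : E.Min j a x' :=
  fun z hz hz' a' ha' he => h z (S.trans hS hz) hz' a' ha' ((RΛ j).trans hR he)

variable {E} in
theorem Min.eq {j : J} {a a' : H} {x x' : X} (hS : S.rel x x') (hx : x ∈ E.sect)
    (hx' : x' ∈ E.sect) (h : E.Min j a x) (h' : E.Min j a' x')
    (hR : (RΛ j).rel (β.act a (E.F x)) (β.act a' (E.F x'))) : a = a' := by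
  rcases E.nf.lt_trichotomy a a' with hlt | rfl | hlt
  · exact absurd ((RΛ j).symm hR) (h' x (S.symm hS) hx a hlt)
  · rfl
  · exact absurd hR (h x' hS hx' a' hlt)

@[fun_prop]
theorem measurable_F : Measurable E.F := E.F_meas

variable [StandardBorelSpace X] [StandardBorelSpace Y] [Countable Γ] [Countable H]

theorem measurable_near (a : H) : Measurable (E.Near a) := by
  unfold Near
  simp only [E.forall_rel]
  have h1 : ∀ γ, Measurable fun x => α.act γ x ∈ E.sect :=
    fun γ => measurable_mem.2 (α.measurable_act γ E.sect_meas)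
  have h2 : ∀ a' γ, Measurable fun x => β.act a' (E.F (α.act γ x)) = β.act a (E.F x) :=
    fun a' γ => measurableSet_setOfPred.1 (measurableSet_eq_fun (by fun_prop) (by fun_prop))
  fun_prop

theorem measurable_min (j : J) (a : H) : Measurable (E.Min j a) := by
  unfold Min
  simp only [E.forall_rel]
  have h1 : ∀ γ, Measurable fun x => α.act γ x ∈ E.sect :=
    fun γ => measurable_mem.2 (α.measurable_act γ E.sect_meas)
  have h2 : ∀ a' γ, Measurable fun x =>
      (RΛ j).rel (β.act a (E.F x)) (β.act a' (E.F (α.act γ x))) :=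
    fun a' γ => (RΛ j).measurable_rel (by fun_prop) (by fun_prop)
  fun_prop

/-- The relation between the points of the section which are closest, via `a`, to a common
`Λ j`-orbit. -/
def main (j : J) (a : H) : CBER X where
  dom := {x | x ∈ E.sect ∧ E.Min j a x}
  dom_meas := measurableSet_setOfPred.2
    ((measurable_mem.2 E.sect_meas).and (E.measurable_min j a))
  rel x x' := S.rel x x' ∧ x ∈ E.sect ∧ x' ∈ E.sect ∧
    (RΛ j).rel (β.act a (E.F x)) (β.act a (E.F x')) ∧ E.Min j a x
  rel_meas := by
    rw [measurableSet_setOfPred]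
    have h1 := S.measurable_rel (measurable_fst (α := X) (β := X)) measurable_snd
    have h2 : Measurable fun p : X × X => p.1 ∈ E.sect :=
      measurable_mem.2 (measurable_fst E.sect_meas)
    have h3 : Measurable fun p : X × X => p.2 ∈ E.sect :=
      measurable_mem.2 (measurable_snd E.sect_meas)
    have h4 : Measurable fun p : X × X =>
        (RΛ j).rel (β.act a (E.F p.1)) (β.act a (E.F p.2)) :=
      (RΛ j).measurable_rel (by fun_prop) (by fun_prop)
    have h5 : Measurable fun p : X × X => E.Min j a p.1 :=
      (E.measurable_min j a).comp measurable_fst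
    fun_prop
  rel_dom := fun ⟨hS, hx, hx', hR, hm⟩ => ⟨⟨hx, hm⟩, hx', E.min_congr hS hR hm⟩
  refl := fun x hx => ⟨E.rel_refl x, hx.1, hx.1, E.relΛ_refl j _, hx.2⟩
  symm := fun ⟨hS, hx, hx', hR, hm⟩ =>
    ⟨S.symm hS, hx', hx, (RΛ j).symm hR, E.min_congr hS hR hm⟩
  trans := fun ⟨hS, hx, _, hR, hm⟩ ⟨hS', _, hx', hR', _⟩ =>
    ⟨S.trans hS hS', hx, hx', (RΛ j).trans hR hR', hm⟩
  countable_classes := fun x => (S.countable_classes x).mono fun _ h => h.1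

/-- The points to be attached to the section, resp. to the points of the section closest to the
`Λ j`-orbit of `a F(x)`. -/
def Pend : Option (J × H) → X → Prop
  | none, x => x ∈ E.core ∧ x ∉ E.sect
  | some (j, a), x => x ∈ E.sect ∧ a ∈ E.nf.T j ∧ E.Near a x ∧
      ∀ a', ¬(E.Min j a' x ∧ (RΛ j).rel (β.act a (E.F x)) (β.act a' (E.F x)))

/-- The points to which `x` may be attached. -/
def Target : Option (J × H) → X → X → Prop
  | none, _, z => z ∈ E.sect
  | some (j, a), x, z => z ∈ E.sect ∧
      ∃ a', E.Min j a' z ∧ (RΛ j).rel (β.act a (E.F x)) (β.act a' (E.F z))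

/-- The points attached via `γ`, and separated from their target by `Q n`. -/
def Src (o : Option (J × H)) (γ : Γ) (n : ℕ) : Set X :=
  {x | E.Pend o x ∧ E.Target o x (α.act γ x) ∧
    (∀ γ', E.code γ' < E.code γ → ¬ E.Target o x (α.act γ' x)) ∧
    (x ∈ E.Q n ∧ α.act γ x ∉ E.Q n) ∧ ∀ m < n, ¬ (x ∈ E.Q m ∧ α.act γ x ∉ E.Q m)}

theorem measurable_pend (o : Option (J × H)) : Measurable (E.Pend o) := by
  have h1 : Measurable fun x => x ∈ E.sect := measurable_mem.2 E.sect_meas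
  rcases o with - | ⟨j, a⟩
  · have h2 : Measurable fun x => x ∈ E.core := measurable_mem.2 E.core_meas
    exact h2.and h1.not
  · unfold Pend
    have h2 := E.measurable_near a
    have h3 := fun a' => E.measurable_min j a'
    have h4 : ∀ a', Measurable fun x => (RΛ j).rel (β.act a (E.F x)) (β.act a' (E.F x)) :=
      fun a' => (RΛ j).measurable_rel (by fun_prop) (by fun_prop)
    fun_prop

theorem measurable_target (o : Option (J × H)) (γ : Γ) :
    Measurable fun x => E.Target o x (α.act γ x) := by
  have h1 : Measurable fun x => α.act γ x ∈ E.sect :=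
    measurable_mem.2 (α.measurable_act γ E.sect_meas)
  rcases o with - | ⟨j, a⟩
  · exact h1
  · unfold Target
    have h3 : ∀ a', Measurable fun x => E.Min j a' (α.act γ x) :=
      fun a' => (E.measurable_min j a').comp (α.measurable_act γ)
    have h4 : ∀ a', Measurable fun x =>
        (RΛ j).rel (β.act a (E.F x)) (β.act a' (E.F (α.act γ x))) :=
      fun a' => (RΛ j).measurable_rel (by fun_prop) (by fun_prop)
    fun_prop

theorem measurableSet_src (o : Option (J × H)) (γ : Γ) (n : ℕ) :
    MeasurableSet (E.Src o γ n) := by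
  unfold Src
  rw [measurableSet_setOfPred]
  have h1 := E.measurable_pend o
  have h2 := E.measurable_target o
  have h3 : ∀ n, Measurable fun x => x ∈ E.Q n := fun n => measurable_mem.2 (E.Q_meas n)
  have h4 : ∀ n, Measurable fun x => α.act γ x ∈ E.Q n :=
    fun n => measurable_mem.2 (α.measurable_act γ (E.Q_meas n))
  fun_prop

/-- The relations into which the orbit relation is decomposed. -/
def fam : Option ((J × H) ⊕ (Option (J × H) × Γ × ℕ)) → CBER X
  | none => S.restrict E.coreᶜ E.core_meas.compl
  | some (.inl (j, a)) => E.main j a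
  | some (.inr (o, γ, n)) => α.edge γ (E.Src o γ n) (E.measurableSet_src o γ n)
      fun _ hx hx' => hx.2.2.2.1.2 hx'.2.2.2.1.1

end OrbitEmbedding

theorem PMPAction.edge_rel_iff {G X : Type} [Group G] [MeasurableSpace X] [MeasurableEq X]
    {μ : Measure X} {α : PMPAction G X μ} {g : G} {P : Set X} {hP : MeasurableSet P}
    {hg : ∀ x ∈ P, α.act g x ∉ P} {w x z : X} (hw : w ∈ P) (hx : x = w ∨ x = α.act g w) :
    (α.edge g P hP hg).rel x z ↔ z = w ∨ z = α.act g w := by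
  refine ⟨fun h => ?_, fun h => ⟨w, hw, hx, h⟩⟩
  have h' : (α.edge g P hP hg).rel w z :=
    (α.edge g P hP hg).trans ⟨w, hw, Or.inl rfl, hx⟩ h
  obtain ⟨w', hw', h1 | h1, h2⟩ := h'
  · rwa [h1]
  · exact absurd (h1 ▸ hw) (hg w' hw')

namespace OrbitEmbedding

variable {X Y Γ H J : Type} [MeasurableSpace X] [MeasurableSpace Y] [Group Γ]
    [Group H] {μ : Measure X} {ν : Measure Y} {α : PMPAction Γ X μ} {S : CBER X}
    {β : PMPAction H Y ν} {Λ : J → Subgroup H} {RΛ : J → CBER Y}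
    (E : OrbitEmbedding α S β Λ RΛ)

theorem eq_of_act_eq (E : OrbitEmbedding α S β Λ RΛ) {x : X} (hx : x ∈ E.sect) {a b : H}
    (h : β.act a (E.F x) = β.act b (E.F x)) : a = b := by
  have : β.act (b⁻¹ * a) (E.F x) = E.F x := by rw [β.act_mul, h, β.inv_act_act]
  exact (inv_mul_eq_one.1 (E.free x hx _ this)).symm

/-- `z` is a point of the section closest to some point of the `Λ j`-orbit of `y`. -/
def Block (j : J) (y : Y) (z : X) : Prop :=
  z ∈ E.sect ∧ ∃ a, E.Near a z ∧ (RΛ j).rel y (β.act a (E.F z))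

theorem exists_block_retraction {x : X} (hx : x ∈ E.sect) (j : J) (a : H) :
    ∃ r : X → H,
      (∀ z z', S.rel x z → S.rel x z' → E.Block j (β.act a (E.F x)) z →
        E.Block j (β.act a (E.F x)) z' → r z = r z' → z = z') ∧
      ∀ j' y z z', S.rel x z → S.rel x z' → E.Block j' y z → E.Block j' y z' →
        ¬(j' = j ∧ (RΛ j).rel y (β.act a (E.F x))) → r z = r z' := by
  classical
  let D : Set H := {h | ∃ z ∈ E.sect, S.rel x z ∧ β.act h (E.F x) = E.F z}
  have hD : D.Nonempty := ⟨1, x, hx, E.rel_refl x, β.act_one _⟩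
  have hc : ∀ z, ∃ c, z ∈ E.sect → S.rel x z → β.act c (E.F x) = E.F z := by
    intro z
    by_cases hz : z ∈ E.sect ∧ S.rel x z
    · obtain ⟨h, hh⟩ := E.equivar x hx z hz.1 hz.2
      exact ⟨h, fun _ _ => hh⟩
    · exact ⟨1, fun h1 h2 => absurd ⟨h1, h2⟩ hz⟩
  choose c hc using hc
  have hcD : ∀ z, z ∈ E.sect → S.rel x z → c z ∈ D := fun z hz hz' => ⟨z, hz, hz', hc z hz hz'⟩
  have hnear : ∀ z a', z ∈ E.sect → S.rel x z → E.Near a' z →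
      E.nf.IsNearest D a' (c z) := by
    rintro z a' hz hz' hn d' ⟨w, hw, hw', hd'⟩ a'' hlt heq
    refine hn w (S.trans (S.symm hz') hw') hw a'' hlt ?_
    rw [← hd', ← hc z hz hz', ← β.act_mul, ← β.act_mul, heq]
  obtain ⟨r, hr1, hr2⟩ := E.nf.exists_coset_retraction hD j a
  refine ⟨fun z => r (c z), ?_, ?_⟩
  · have key : ∀ z, S.rel x z → E.Block j (β.act a (E.F x)) z → r (c z) = c z := by
      rintro z hz ⟨hzs, a', hn, hR⟩
      obtain ⟨l, hl, hle⟩ := (E.relΛ_iff _ _ _).1 hR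
      rw [← hc z hzs hz, ← β.act_mul, ← β.act_mul] at hle
      refine hr1 a' (c z) (hcD z hzs hz) (hnear z a' hzs hz hn) ?_
      rw [← E.eq_of_act_eq hx hle]
      simpa using hl
    intro z z' hz hz' hb hb' he
    have he' : r (c z) = r (c z') := he
    rw [key z hz hb, key z' hz' hb'] at he'
    apply E.inj hb.1 hb'.1
    rw [← hc z hb.1 hz, ← hc z' hb'.1 hz', he']
  · rintro j' y z z' hz hz' ⟨hzs, a₁, hn, hR⟩ ⟨hzs', a₂, hn', hR'⟩ hne
    obtain ⟨l, hl, hle⟩ := (E.relΛ_iff _ _ _).1 hR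
    obtain ⟨l', hl', hle'⟩ := (E.relΛ_iff _ _ _).1 hR'
    have hy := β.eq_inv_act hle
    rw [← hc z hzs hz, ← β.act_mul, ← β.act_mul] at hy
    rw [← hc z' hzs' hz', hy, ← β.act_mul, ← β.act_mul] at hle'
    have hle' := E.eq_of_act_eq hx hle'
    refine hr2 j' (l⁻¹ * (a₁ * c z)) a₁ (c z) a₂ (c z') (hcD z hzs hz) (hcD z' hzs' hz')
      (hnear _ _ hzs hz hn) (hnear _ _ hzs' hz' hn') ?_ ?_ ?_
    · simpa [mul_assoc] using hl
    · rw [← hle']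
      simpa [mul_assoc] using hl'
    · rintro ⟨rfl, hb⟩
      refine hne ⟨rfl, (E.relΛ_iff _ _ _).2 ⟨_, inv_mem hb, ?_⟩⟩
      rw [hy, ← β.act_mul]
      congr 1
      group

variable {E} in
theorem Src.unique {o : Option (J × H)} {γ γ' : Γ} {n n' : ℕ} {w : X} (h : w ∈ E.Src o γ n)
    (h' : w ∈ E.Src o γ' n') : γ = γ' ∧ n = n' := by
  obtain ⟨-, h2, h3, h4, h5⟩ := h
  obtain ⟨-, h2', h3', h4', h5'⟩ := h'
  have : γ = γ' := by
    apply E.code_inj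
    rcases lt_trichotomy (E.code γ) (E.code γ') with hl | hl | hl
    · exact absurd h2 (h3' _ hl)
    · exact hl
    · exact absurd h2' (h3 _ hl)
  subst this
  refine ⟨rfl, ?_⟩
  rcases lt_trichotomy n n' with hl | hl | hl
  · exact absurd h4 (h5' _ hl)
  · exact hl
  · exact absurd h4' (h5 _ hl)

variable {E} in
theorem block_of_src {j : J} {a : H} {γ : Γ} {n : ℕ} {w z : X}
    (hw : w ∈ E.Src (some (j, a)) γ n) (hz : z = w ∨ z = α.act γ w) :
    E.Block j (β.act a (E.F w)) z := by
  obtain ⟨⟨h1, -, h2, -⟩, ⟨h3, a', h4, h5⟩, -⟩ := hw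
  rcases hz with rfl | rfl
  · exact ⟨h1, a, h2, E.relΛ_refl _ _⟩
  · exact ⟨h3, a', h4.near, h5⟩

theorem rel_of_edge (E : OrbitEmbedding α S β Λ RΛ) {γ : Γ} {w z : X}
    (hz : z = w ∨ z = α.act γ w) : S.rel w z := by
  rcases hz with rfl | rfl
  · exact E.rel_refl _
  · exact E.rel_act _ _

variable [StandardBorelSpace X] [StandardBorelSpace Y] [Countable Γ] [Countable H]

theorem rel_of_fam : ∀ k x y, (E.fam k).rel x y → S.rel x y := by
  rintro (- | ⟨j, a⟩ | ⟨o, γ, n⟩) x y h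
  · exact h.1
  · exact h.1
  · obtain ⟨w, -, h1, h2⟩ := h
    have : ∀ x, (x = w ∨ x = α.act γ w) → S.rel w x := by
      rintro x (rfl | rfl)
      · exact E.rel_refl _
      · exact E.rel_act _ _
    exact S.trans (S.symm (this x h1)) (this y h2)

/-- The order in which the pieces are used to check free independence. -/
def rank : Option ((J × H) ⊕ (Option (J × H) × Γ × ℕ)) → ℕ
  | none => 0
  | some (.inl _) => 0
  | some (.inr (some _, _, _)) => 1
  | some (.inr (none, _, _)) => 2

variable {E} in
theorem block_of_main {j : J} {a : H} {z z' : X} (h : (E.main j a).rel z z') :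
    E.Block j (β.act a (E.F z)) z ∧ E.Block j (β.act a (E.F z)) z' := by
  obtain ⟨hS, hz, hz', hR, hm⟩ := h
  exact ⟨⟨hz, a, hm.near, E.relΛ_refl _ _⟩, ⟨hz', a, (E.min_congr hS hR hm).near, hR⟩⟩

variable {E} in
theorem fam_edge_rel_iff {o : Option (J × H)} {γ : Γ} {n : ℕ} {w x z : X}
    (hw : w ∈ E.Src o γ n) (hx : x = w ∨ x = α.act γ w) :
    (E.fam (some (.inr (o, γ, n)))).rel x z ↔ z = w ∨ z = α.act γ w :=
  PMPAction.edge_rel_iff (hP := E.measurableSet_src o γ n)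
    (hg := fun _ hx hx' => hx.2.2.2.1.2 hx'.2.2.2.1.1) hw hx

theorem freelyIndep_fam : FreelyIndep E.fam := by
  refine freelyIndep_of_retractions E.rel_of_fam rank ?_
  rintro (- | ⟨j, a⟩ | ⟨- | ⟨j, a⟩, γ, n⟩) x y hxy hne
  · refine ⟨X, id, fun z z' _ _ h => h, ?_⟩
    rintro (- | ⟨j, a⟩ | ⟨- | ⟨j, a⟩, γ, n⟩) z z' hr hS h hk
    · exact absurd ⟨rfl, hS, hxy.2.1, h.2.1⟩ hk
    · exact absurd (E.mem_core (S.symm hS) (E.sect_sub h.2.1)) hxy.2.1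
    · exact absurd hr (by simp [rank])
    · exact absurd hr (by simp [rank])
  · obtain ⟨-, hx, -, -, hmx⟩ := hxy
    obtain ⟨r, hr1, hr2⟩ := E.exists_block_retraction hx j a
    refine ⟨H, r, ?_, ?_⟩
    · intro z z' hz hz'
      exact hr1 z z' hz.1 hz'.1 (block_of_main hz).2 (block_of_main hz').2
    · rintro (- | ⟨j', a'⟩ | ⟨- | ⟨j', a'⟩, γ, n⟩) z z' hr hS h hk
      · exact absurd (E.mem_core hS (E.sect_sub hx)) h.2.1
      · refine hr2 j' (β.act a' (E.F z)) z z' hS (S.trans hS h.1) (block_of_main h).1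
          (block_of_main h).2 ?_
        rintro ⟨rfl, hR⟩
        obtain rfl : a = a' := hmx.eq hS hx h.2.1 h.2.2.2.2 ((RΛ j').symm hR)
        exact hk ⟨rfl, hS, hx, h.2.1, (RΛ j').symm hR, hmx⟩
      · exact absurd hr (by simp [rank])
      · exact absurd hr (by simp [rank])
  · obtain ⟨w, hw, hx, hy⟩ := hxy
    have hws : w ∉ E.sect := hw.1.2
    refine ⟨Prop, fun z => z = w, ?_, ?_⟩
    · intro z z' hz hz' he
      have hz := (fam_edge_rel_iff hw hx).1 hz
      have hz' := (fam_edge_rel_iff hw hx).1 hz'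
      have he : z = w ↔ z' = w := iff_of_eq he
      grind
    · have hwx : S.rel w x := E.rel_of_edge hx
      rintro (- | ⟨j', a'⟩ | ⟨- | ⟨j', a'⟩, γ', n'⟩) z z' hr hS h hk
      · exact absurd (E.mem_core (S.trans hwx hS) hw.1.1) h.2.1
      · refine propext ⟨?_, ?_⟩
        · rintro rfl
          exact absurd h.2.1 hws
        · rintro rfl
          exact absurd h.2.2.1 hws
      · obtain ⟨w', hw', hz, hz'⟩ := h
        have ht : α.act γ' w' ∈ E.sect := hw'.2.1
        by_cases hww : w' = w
        · subst hww
          obtain ⟨rfl, rfl⟩ := Src.unique hw hw'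
          exact absurd ⟨rfl, (fam_edge_rel_iff hw hx).2 hz⟩ hk
        · have : α.act γ' w' ≠ w := fun h => hws (h ▸ ht)
          exact propext (by grind)
      · obtain ⟨w', hw', hz, hz'⟩ := h
        have h1 := (block_of_src hw' hz).1
        have h2 := (block_of_src hw' hz').1
        exact propext (by grind)
  · obtain ⟨w, hw, hx, hy⟩ := hxy
    have hws : w ∈ E.sect := hw.1.1
    have hwx : S.rel w x := E.rel_of_edge hx
    obtain ⟨r, hr1, hr2⟩ := E.exists_block_retraction hws j a
    have hbw : E.Block j (β.act a (E.F w)) w := block_of_src hw (Or.inl rfl)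
    have hPw : ∀ a', ¬(E.Min j a' w ∧ (RΛ j).rel (β.act a (E.F w)) (β.act a' (E.F w))) :=
      hw.1.2.2.2
    have hri : ∀ z, S.rel w z → E.Block j (β.act a (E.F w)) z → (r z = r w ↔ z = w) :=
      fun z hz hb => ⟨hr1 z w hz (E.rel_refl w) hb hbw, fun h => h ▸ rfl⟩
    refine ⟨Prop, fun z => r z = r w, ?_, ?_⟩
    · intro z z' hz hz' he
      have hz := (fam_edge_rel_iff hw hx).1 hz
      have hz' := (fam_edge_rel_iff hw hx).1 hz'
      have he : r z = r w ↔ r z' = r w := iff_of_eq he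
      rw [hri z (E.rel_of_edge hz) (block_of_src hw hz),
        hri z' (E.rel_of_edge hz') (block_of_src hw hz')] at he
      grind
    · have move : ∀ {j' y z}, E.Block j' y z → (j' = j ∧ (RΛ j).rel y (β.act a (E.F w))) →
          E.Block j (β.act a (E.F w)) z := by
        rintro j' y z ⟨h1, a', h2, h3⟩ ⟨rfl, hR⟩
        exact ⟨h1, a', h2, (RΛ j').trans ((RΛ j').symm hR) h3⟩
      rintro (- | ⟨j', a'⟩ | ⟨- | ⟨j', a'⟩, γ', n'⟩) z z' hr hS h hk
      · exact absurd (E.mem_core (S.trans hwx hS) (E.sect_sub hws)) h.2.1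
      · have hwz := S.trans hwx hS
        have hwz' := S.trans hwz h.1
        obtain ⟨hb, hb'⟩ := block_of_main h
        by_cases hsame : j' = j ∧ (RΛ j).rel (β.act a' (E.F z)) (β.act a (E.F w))
        · refine propext (show r z = r w ↔ r z' = r w from ?_)
          rw [hri z hwz (move hb hsame), hri z' hwz' (move hb' hsame)]
          obtain ⟨rfl, hR⟩ := hsame
          have h1 : z ≠ w := by
            rintro rfl
            exact hPw a' ⟨h.2.2.2.2, (RΛ j').symm hR⟩
          have h2 : z' ≠ w := by
            rintro rfl
            exact hPw a' ⟨E.min_congr h.1 h.2.2.2.1 h.2.2.2.2,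
              (RΛ j').trans ((RΛ j').symm hR) h.2.2.2.1⟩
          simp [h1, h2]
        · show (r z = r w) = (r z' = r w)
          rw [hr2 _ _ z z' hwz hwz' hb hb' hsame]
      · exact absurd hr (by simp [rank])
      · obtain ⟨w', hw', hz, hz'⟩ := h
        have hwz := S.trans hwx hS
        have hww' := S.trans hwz (S.symm (E.rel_of_edge hz))
        have hwz' := S.trans hww' (E.rel_of_edge hz')
        have hb := block_of_src hw' hz
        have hb' := block_of_src hw' hz'
        by_cases hsame : j' = j ∧ (RΛ j).rel (β.act a' (E.F w')) (β.act a (E.F w))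
        · refine propext (show r z = r w ↔ r z' = r w from ?_)
          rw [hri z hwz (move hb hsame), hri z' hwz' (move hb' hsame)]
          obtain ⟨rfl, hR⟩ := hsame
          by_cases hww : w' = w
          · subst hww
            obtain ⟨l, hl, hle⟩ := (E.relΛ_iff _ _ _).1 hR
            rw [← β.act_mul] at hle
            have hla := E.eq_of_act_eq hws hle
            have hT : a ∈ E.nf.T j' := hw.1.2.1
            have hT' : a' ∈ E.nf.T j' := hw'.1.2.1
            obtain rfl : l = 1 := E.nf.tail_unique hT' hl (hla ▸ hT)
            obtain rfl : a' = a := by simpa using hla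
            obtain ⟨rfl, rfl⟩ := Src.unique hw hw'
            exact absurd ⟨rfl, (fam_edge_rel_iff hw hx).2 hz⟩ hk
          · have : α.act γ' w' ≠ w := by
              intro he
              obtain ⟨-, a'', hm, hR'⟩ := hw'.2.1
              rw [he] at hm hR'
              exact hPw a'' ⟨hm, (RΛ j').trans ((RΛ j').symm hR) hR'⟩
            grind
        · show (r z = r w) = (r z' = r w)
          rw [hr2 _ _ z z' hwz hwz' hb hb' hsame]

end OrbitEmbedding

theorem FreeNormalForm.not_lt_one {H J : Type} [Group H] {Λ : J → Subgroup H}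
    (nf : FreeNormalForm Λ) (a : H) : ¬ nf.lt a 1 := by
  unfold FreeNormalForm.lt
  rw [nf.key_one]
  exact List.not_shortlex_nil_right

namespace OrbitEmbedding

variable {X Y Γ H J : Type} [MeasurableSpace X] [MeasurableSpace Y] [Group Γ]
    [Group H] {μ : Measure X} {ν : Measure Y} {α : PMPAction Γ X μ} {S : CBER X}
    {β : PMPAction H Y ν} {Λ : J → Subgroup H} {RΛ : J → CBER Y}
    (E : OrbitEmbedding α S β Λ RΛ)

theorem exists_mem_src {o : Option (J × H)} {x z : X} (hx : E.Pend o x) (hS : S.rel x z)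
    (hz : E.Target o x z) : ∃ γ n, x ∈ E.Src o γ n := by
  classical
  obtain ⟨γ₀, rfl⟩ := E.exists_act hS
  obtain ⟨γ, hγ, hmin⟩ := (InvImage.wf E.code Nat.lt_wfRel.wf).has_min
    {γ | E.Target o x (α.act γ x)} ⟨γ₀, hz⟩
  have hne : x ≠ α.act γ x := by
    intro he
    have hγ' : E.Target o x (α.act γ x) := hγ
    rw [← he] at hγ'
    rcases o with - | ⟨j, a⟩
    · exact hx.2 hγ'
    · obtain ⟨-, a', h⟩ := hγ'
      exact hx.2.2.2 a' h
  have hn := E.Q_sep _ _ hne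
  exact ⟨γ, Nat.find hn, hx, hγ, fun γ' hlt h => hmin γ' h hlt, Nat.find_spec hn,
    fun m hm => Nat.find_min hn hm⟩

variable [StandardBorelSpace X] [StandardBorelSpace Y] [Countable Γ] [Countable H]

/-- Equivalence under the relation generated by the pieces. -/
def Con (x y : X) : Prop := Relation.EqvGen (fun a b => ∃ k, (E.fam k).rel a b) x y

variable {E} in
theorem Con.of_fam {x y : X} (k) (h : (E.fam k).rel x y) : E.Con x y := .rel _ _ ⟨k, h⟩

variable {E} in
theorem Con.symm {x y : X} (h : E.Con x y) : E.Con y x := Relation.EqvGen.symm _ _ h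

variable {E} in
theorem Con.trans {x y z : X} (h : E.Con x y) (h' : E.Con y z) : E.Con x z :=
  Relation.EqvGen.trans _ _ _ h h'

theorem Con.refl (x : X) : E.Con x x := Relation.EqvGen.refl _

theorem exists_con_target {o : Option (J × H)} {x z : X} (hx : E.Pend o x) (hS : S.rel x z)
    (hz : E.Target o x z) : ∃ w, S.rel x w ∧ E.Target o x w ∧ E.Con x w := by
  obtain ⟨γ, n, h⟩ := E.exists_mem_src hx hS hz
  exact ⟨_, E.rel_act γ x, h.2.1,
    .of_fam (some (.inr (o, γ, n))) ((fam_edge_rel_iff h (Or.inl rfl)).2 (Or.inr rfl))⟩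

theorem exists_con_min {z : X} (hz : z ∈ E.sect) {a : H} (ha : E.Near a z) (j : J) :
    ∃ w ∈ E.sect, S.rel z w ∧ E.Con z w ∧
      ∃ a', E.Min j a' w ∧ (RΛ j).rel (β.act a (E.F z)) (β.act a' (E.F w)) := by
  obtain ⟨l, hl, a₁, ha₁, rfl⟩ := E.nf.exists_tail j a
  have hR : (RΛ j).rel (β.act (l * a₁) (E.F z)) (β.act a₁ (E.F z)) := by
    rw [β.act_mul]
    exact (RΛ j).symm (E.relΛ_act hl _)
  have hnear : E.Near a₁ z := by
    by_cases hl1 : l = 1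
    · simpa [hl1] using ha
    · intro z' hz' hzs b hb he
      refine ha z' hz' hzs (l * b) (E.nf.lt_cons_of_lt hl hl1 ha₁ hb) ?_
      rw [β.act_mul, he, ← β.act_mul]
  by_cases hm : ∃ a', E.Min j a' z ∧ (RΛ j).rel (β.act a₁ (E.F z)) (β.act a' (E.F z))
  · obtain ⟨a', hm, hR'⟩ := hm
    exact ⟨z, hz, E.rel_refl z, Con.refl E z, a', hm, (RΛ j).trans hR hR'⟩
  · have hP : E.Pend (some (j, a₁)) z := ⟨hz, ha₁, hnear, not_exists.1 hm⟩
    obtain ⟨a', ⟨w, hw, hzw, hRw⟩, hmin⟩ := E.nf.lt_wf.has_min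
      {a' | ∃ w ∈ E.sect, S.rel z w ∧ (RΛ j).rel (β.act a₁ (E.F z)) (β.act a' (E.F w))}
      ⟨a₁, z, hz, E.rel_refl z, E.relΛ_refl _ _⟩
    have hT : E.Target (some (j, a₁)) z w :=
      ⟨hw, a', fun z' hz' hzs b hb hR' =>
        hmin b ⟨z', hzs, S.trans hzw hz', (RΛ j).trans hRw hR'⟩ hb, hRw⟩
    obtain ⟨w, hzw, ⟨hw, a', hm', hR'⟩, hc⟩ := E.exists_con_target hP hzw hT
    exact ⟨w, hw, hzw, hc, a', hm', (RΛ j).trans hR hR'⟩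

theorem con_of_near {z z' : X} (hz : z ∈ E.sect) (hz' : z' ∈ E.sect) (hS : S.rel z z')
    {a a' : H} (ha : E.Near a z) (ha' : E.Near a' z') {j : J}
    (hR : (RΛ j).rel (β.act a (E.F z)) (β.act a' (E.F z'))) : E.Con z z' := by
  obtain ⟨w, hw, hzw, hc, b, hm, hRw⟩ := E.exists_con_min hz ha j
  obtain ⟨w', hw', hzw', hc', b', hm', hRw'⟩ := E.exists_con_min hz' ha' j
  have hww : S.rel w w' := S.trans (S.symm hzw) (S.trans hS hzw')
  have hRR : (RΛ j).rel (β.act b (E.F w)) (β.act b' (E.F w')) :=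
    (RΛ j).trans ((RΛ j).symm hRw) ((RΛ j).trans hR hRw')
  obtain rfl := hm.eq hww hw hw' hm' hRR
  exact (hc.trans (.of_fam (some (.inl (j, b))) ⟨hww, hw, hw', hRR, hm⟩)).trans hc'.symm

theorem con_of_sect {x x' : X} (hx : x ∈ E.sect) (hx' : x' ∈ E.sect) (hS : S.rel x x') :
    E.Con x x' := by
  have key : ∀ h : H, ∀ z ∈ E.sect, S.rel x z → ∀ a, E.Near a z →
      β.act a (E.F z) = β.act h (E.F x) → E.Con x z := by
    intro h
    induction h using E.nf.cons_induction with
    | one =>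
      intro z hz hxz a ha he
      obtain rfl : a = 1 := by
        by_contra h1
        exact ha x (S.symm hxz) hx 1 (E.nf.one_lt h1) he.symm
      rw [β.act_one, β.act_one] at he
      rw [E.inj hz hx he]
      exact Con.refl E x
    | cons i l h' hl _ _ ih =>
      intro z hz hxz a ha he
      obtain ⟨b, ⟨w, hw, hxw, hb⟩, hmin⟩ := E.nf.lt_wf.has_min
        {b | ∃ w ∈ E.sect, S.rel x w ∧ β.act b (E.F w) = β.act h' (E.F x)}
        ⟨h', x, hx, E.rel_refl x, rfl⟩
      have hnear : E.Near b w := fun w' hw' hws b' hlt hb' =>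
        hmin b' ⟨w', hws, S.trans hxw hw', hb'.trans hb⟩ hlt
      refine (ih w hw hxw b hnear hb).trans
        (E.con_of_near hw hz (S.trans (S.symm hxw) hxz) hnear ha (j := i) ?_)
      rw [he, hb, β.act_mul]
      exact E.relΛ_act hl _
  obtain ⟨h, hh⟩ := E.equivar x hx x' hx' hS
  exact key h x' hx' hS 1 (fun _ _ _ a' hlt => absurd hlt (E.nf.not_lt_one a'))
    (by rw [β.act_one, hh])

theorem con_of_rel {x x' : X} (hS : S.rel x x') : E.Con x x' := by
  by_cases hx : x ∈ E.core
  · have hatt : ∀ x ∈ E.core, ∃ z ∈ E.sect, S.rel x z ∧ E.Con x z := by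
      intro x hx
      by_cases hxs : x ∈ E.sect
      · exact ⟨x, hxs, E.rel_refl x, Con.refl E x⟩
      · obtain ⟨γ, hγ⟩ := E.hit x hx
        obtain ⟨z, h1, h2, h3⟩ := E.exists_con_target (o := none) ⟨hx, hxs⟩ (E.rel_act γ x) hγ
        exact ⟨z, h2, h1, h3⟩
    obtain ⟨z, hz, hxz, hc⟩ := hatt x hx
    obtain ⟨z', hz', hxz', hc'⟩ := hatt x' (E.mem_core hS hx)
    exact (hc.trans (E.con_of_sect hz hz' (S.trans (S.symm hxz) (S.trans hS hxz')))).trans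
      hc'.symm
  · exact .of_fam none ⟨hS, hx, fun hx' => hx (E.mem_core (S.symm hS) hx')⟩

theorem isFreeProduct_fam [Nonempty J] : IsFreeProduct S E.fam := by
  refine ⟨E.freelyIndep_fam, ?_, fun x y => ⟨fun h => ⟨E.mem_dom x, E.con_of_rel h⟩, ?_⟩⟩
  · refine Set.Subset.antisymm (fun x _ => ?_) (fun x _ => E.mem_dom x)
    rw [Set.mem_iUnion]
    by_cases hx : x ∈ E.core
    · by_cases hxs : x ∈ E.sect
      · obtain ⟨j⟩ := ‹Nonempty J›
        exact ⟨some (.inl (j, 1)), hxs, fun _ _ _ a' hlt => absurd hlt (E.nf.not_lt_one a')⟩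
      · obtain ⟨γ, hγ⟩ := E.hit x hx
        obtain ⟨γ, n, h⟩ := E.exists_mem_src (o := none) ⟨hx, hxs⟩ (E.rel_act γ x) hγ
        exact ⟨some (.inr (none, γ, n)), Or.inl h⟩
    · exact ⟨none, E.mem_dom x, hx⟩
  · rintro ⟨-, h⟩
    induction h with
    | rel x y h => exact E.rel_of_fam _ _ _ h.choose_spec
    | refl x => exact E.rel_refl x
    | symm _ _ _ ih => exact S.symm ih
    | trans _ _ _ _ _ ih ih' => exact S.trans ih ih'

end OrbitEmbedding

namespace PMPAction

variable {G X : Type} [Group G] [MeasurableSpace X] {μ : Measure X} (α : PMPAction G X μ)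

theorem measure_preimage (g : G) {V : Set X} (hV : MeasurableSet V) :
    μ (α.act g ⁻¹' V) = μ V :=
  (α.measurePreserving g).measure_preimage hV.nullMeasurableSet

/-- A set of positive measure contains three points of some orbit of an infinite group. -/
theorem exists_recurrence [Infinite G] [IsProbabilityMeasure μ] {V : Set X}
    (hV : MeasurableSet V) (hpos : 0 < μ V) :
    ∃ x ∈ V, ∃ k₁ k₂ : G, k₁ ≠ 1 ∧ k₂ ≠ 1 ∧ k₁ ≠ k₂ ∧ α.act k₁ x ∈ V ∧ α.act k₂ x ∈ V := by
  classical
  by_contra! hcon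
  have hcard : ∀ (s : Finset G) (x : X), (s.filter fun g => α.act g x ∈ V).card ≤ 2 := by
    intro s x
    by_contra! hlt
    obtain ⟨a, b, c, ha, hb, hc, hab, hac, hbc⟩ := Finset.two_lt_card_iff.1 hlt
    simp only [Finset.mem_filter] at ha hb hc
    refine hcon (α.act a x) ha.2 (b * a⁻¹) (c * a⁻¹) ?_ ?_ ?_ ?_ ?_
    · exact fun h => hab (mul_inv_eq_one.1 h).symm
    · exact fun h => hac (mul_inv_eq_one.1 h).symm
    · exact fun h => hbc (mul_right_cancel h)
    · rw [← α.act_mul]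
      simpa using hb.2
    · rw [← α.act_mul]
      simpa using hc.2
  have hsum : ∀ s : Finset G, (s.card : ENNReal) * μ V ≤ 2 := by
    intro s
    calc (s.card : ENNReal) * μ V = ∑ g ∈ s, μ (α.act g ⁻¹' V) := by
          simp [α.measure_preimage _ hV]
      _ = ∑ g ∈ s, ∫⁻ x, (α.act g ⁻¹' V).indicator 1 x ∂μ := by
          refine Finset.sum_congr rfl fun g _ => ?_
          rw [lintegral_indicator_one (α.measurable_act g hV)]
      _ = ∫⁻ x, ∑ g ∈ s, (α.act g ⁻¹' V).indicator 1 x ∂μ := by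
          rw [lintegral_finsetSum]
          exact fun g _ => measurable_one.indicator (α.measurable_act g hV)
      _ ≤ ∫⁻ _, 2 ∂μ := by
          refine lintegral_mono fun x => ?_
          have : ∑ g ∈ s, (α.act g ⁻¹' V).indicator (1 : X → ENNReal) x =
              ((s.filter fun g => α.act g x ∈ V).card : ENNReal) := by
            simp [Set.indicator_apply]
          show ∑ g ∈ s, (α.act g ⁻¹' V).indicator (1 : X → ENNReal) x ≤ 2
          rw [this]
          exact_mod_cast hcard s x
      _ = 2 := by simp
  obtain ⟨n, hn⟩ := ENNReal.exists_nat_mul_gt hpos.ne' (by simp : (2 : ENNReal) ≠ ⊤)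
  obtain ⟨s, hs⟩ := Infinite.exists_subset_card_eq G n
  exact absurd (hsum s) (not_le.2 (hs ▸ hn))

/-- A conull set contains an invariant conull set. -/
theorem exists_invariant_conull [Countable G] {C : Set X} (hC : MeasurableSet C)
    (h : μ Cᶜ = 0) : ∃ D ⊆ C, MeasurableSet D ∧ μ Dᶜ = 0 ∧ ∀ g, ∀ x ∈ D, α.act g x ∈ D := by
  refine ⟨⋂ g, α.act g ⁻¹' C, fun x hx => ?_, .iInter fun g => α.measurable_act g hC, ?_, ?_⟩
  · simpa [α.act_one] using Set.mem_iInter.1 hx 1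
  · rw [Set.compl_iInter, measure_iUnion_null_iff]
    intro g
    rw [← Set.preimage_compl, α.measure_preimage g hC.compl, h]
  · intro g x hx
    rw [Set.mem_iInter] at hx ⊢
    intro g'
    have := hx (g' * g)
    rwa [Set.mem_preimage, α.act_mul] at this

end PMPAction

theorem OrbitEmbedding.exists_main {X Y Γ H J : Type} [MeasurableSpace X] [MeasurableSpace Y]
    [Group Γ] [Group H] {μ : Measure X} {ν : Measure Y} {α : PMPAction Γ X μ} {S : CBER X}
    {β : PMPAction H Y ν} {Λ : J → Subgroup H} {RΛ : J → CBER Y}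
    [StandardBorelSpace X] [StandardBorelSpace Y] [Countable Γ] [Countable H] [Infinite Γ]
    [Countable J] [Nonempty J] [IsProbabilityMeasure μ] (E : OrbitEmbedding α S β Λ RΛ)
    (hcore : μ E.coreᶜ = 0) (hfree : ∀ x ∈ E.core, ∀ γ, α.act γ x = x → γ = 1)
    (hFI : FreelyIndecomposableMod μ S) :
    ∃ V ⊆ E.sect, MeasurableSet V ∧ 0 < μ V ∧ ∃ j a, ∀ x ∈ V, ∀ x' ∈ V, S.rel x x' →
      (RΛ j).rel (β.act a (E.F x)) (β.act a (E.F x')) := by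
  obtain ⟨U, C, hUm, -, -, hCm, hC, hsec, -, hUrel⟩ := hFI _ inferInstance _ E.isFreeProduct_fam
  obtain ⟨D, hDC, hDm, hD, hDinv⟩ := α.exists_invariant_conull (hCm.inter E.core_meas) (by
    rw [Set.compl_inter]
    exact measure_union_null hC hcore)
  have hcov : D ⊆ ⋃ k, ⋃ γ, α.act γ ⁻¹' (U k ∩ D) := by
    intro x hx
    obtain ⟨y, hy, hxy⟩ := hsec x ⟨E.mem_dom x, (hDC hx).1⟩
    obtain ⟨k, hk⟩ := Set.mem_iUnion.1 hy
    obtain ⟨γ, rfl⟩ := E.exists_act hxy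
    exact Set.mem_iUnion.2 ⟨k, Set.mem_iUnion.2 ⟨γ, hk, hDinv γ x hx⟩⟩
  have hVm : ∀ k, MeasurableSet (U k ∩ D) := fun k => (hUm k).inter hDm
  have hVpos : ∃ k, 0 < μ (U k ∩ D) := by
    by_contra! hcon
    have h0 : μ D = 0 := by
      refine measure_mono_null hcov (measure_iUnion_null fun k => measure_iUnion_null fun γ => ?_)
      rw [α.measure_preimage γ (hVm k)]
      exact le_antisymm (hcon k) bot_le
    have := (prob_compl_eq_zero_iff hDm).1 hD
    simp [h0] at this
  obtain ⟨k, hk⟩ := hVpos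
  have hrel : ∀ x ∈ U k ∩ D, ∀ x' ∈ U k ∩ D, S.rel x x' → (E.fam k).rel x x' :=
    fun x hx x' hx' => (hUrel k x ⟨hx.1, (hDC hx.2).1⟩ x' ⟨hx'.1, (hDC hx'.2).1⟩).1
  rcases k with - | ⟨j, a⟩ | ⟨o, γ, n⟩
  · obtain ⟨x, hx⟩ := nonempty_of_measure_ne_zero hk.ne'
    exact absurd (hDC hx.2).2 (hrel x hx x hx (E.rel_refl x)).2.1
  · exact ⟨_, fun x hx => (hrel x hx x hx (E.rel_refl x)).2.1, hVm _, hk, j, a,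
      fun x hx x' hx' h => (hrel x hx x' hx' h).2.2.2.1⟩
  · exfalso
    obtain ⟨x, hx, k₁, k₂, h1, h2, h12, hx1, hx2⟩ := α.exists_recurrence (hVm _) hk
    have hfx := hfree x (hDC hx.2).2
    have e1 : α.act k₁ x ≠ x := fun h => h1 (hfx _ h)
    have e2 : α.act k₂ x ≠ x := fun h => h2 (hfx _ h)
    have e12 : α.act k₁ x ≠ α.act k₂ x := by
      intro h
      have : α.act (k₂⁻¹ * k₁) x = x := by rw [α.act_mul, h, α.inv_act_act]
      exact h12 (inv_mul_eq_one.1 (hfx _ this)).symm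
    obtain ⟨w, hw, hxw, hk1⟩ := hrel x hx _ hx1 (E.rel_act k₁ x)
    have hk2 := (fam_edge_rel_iff hw hxw).1 (hrel x hx _ hx2 (E.rel_act k₂ x))
    grind

namespace PMPAction

variable {G X : Type} [Group G] [MeasurableSpace X] {μ : Measure X} (α : PMPAction G X μ)

/-- The restriction of an action to a subgroup. -/
def restrict (K : Subgroup G) : PMPAction K X μ where
  act k := α.act k
  act_one := α.act_one
  act_mul k k' := α.act_mul k k'
  measurePreserving k := α.measurePreserving k

variable {α}

theorem IsFree.restrict (h : α.IsFree) (K : Subgroup G) : (α.restrict K).IsFree := by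
  filter_upwards [h] with x hx k hk
  exact Subtype.ext (hx k hk)

theorem measurableSet_free [Countable G] [MeasurableEq X] (α : PMPAction G X μ) :
    MeasurableSet {x | ∀ g : G, α.act g x = x → g = 1} := by
  rw [measurableSet_setOfPred]
  have : ∀ g, Measurable fun x => α.act g x = x := fun g =>
    measurableSet_setOfPred.1 (measurableSet_eq_fun (α.measurable_act g) measurable_id)
  fun_prop

end PMPAction

theorem IsOrbitRel.restrict {G X : Type} [Group G] [MeasurableSpace X] {μ : Measure X}
    {α : PMPAction G X μ} {K : Subgroup G} {R : CBER X} (h : IsOrbitRel α K R) :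
    IsOrbitRel (α.restrict K) ⊤ R := by
  refine ⟨h.1, fun x y => (h.2 x y).trans ⟨?_, ?_⟩⟩
  · rintro ⟨k, hk, he⟩
    exact ⟨⟨k, hk⟩, trivial, he⟩
  · rintro ⟨k, -, he⟩
    exact ⟨k, k.2, he⟩

theorem measurableSet_saturation {G X : Type} [Group G] [Countable G] [MeasurableSpace X]
    {μ : Measure X} (α : PMPAction G X μ) (K : Subgroup G) {V : Set X} (hV : MeasurableSet V) :
    MeasurableSet {x | ∃ k ∈ K, α.act k x ∈ V} := by
  have : {x | ∃ k ∈ K, α.act k x ∈ V} = ⋃ k ∈ K, α.act k ⁻¹' V := by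
    ext x
    simp
  rw [this]
  exact .iUnion fun k => .iUnion fun _ => α.measurable_act k hV

theorem ErgodicCBER.saturation_conull {G X : Type} [Group G] [Countable G] [MeasurableSpace X]
    {μ : Measure X} {α : PMPAction G X μ} {K : Subgroup G} {R : CBER X} (herg : ErgodicCBER R μ)
    (hR : IsOrbitRel α K R) {V : Set X} (hV : MeasurableSet V) (hpos : 0 < μ V) :
    μ {x | ∃ k ∈ K, α.act k x ∈ V}ᶜ = 0 := by
  refine (herg _ (measurableSet_saturation α K hV) ?_).resolve_left ?_
  · rintro x ⟨k, hk, hx⟩ y hxy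
    obtain ⟨k', hk', rfl⟩ := (hR.2 _ _).1 hxy
    exact ⟨k * k'⁻¹, mul_mem hk (inv_mem hk'), by rwa [α.act_mul, α.inv_act_act]⟩
  · have : V ⊆ {x | ∃ k ∈ K, α.act k x ∈ V} := fun x hx => ⟨1, one_mem K, by rwa [α.act_one]⟩
    exact (hpos.trans_le (measure_mono this)).ne'

namespace SOEquiv

variable {X Y : Type} [MeasurableSpace X] [MeasurableSpace Y] {R : CBER X} {μ : Measure X}
  {S : CBER Y} {ν : Measure Y} (E : SOEquiv R μ S ν)

theorem image_eq {V : Set X} (hV : V ⊆ E.A) : E.toFun '' V = E.B ∩ E.invFun ⁻¹' V := by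
  ext y
  constructor
  · rintro ⟨x, hx, rfl⟩
    exact ⟨E.mapsTo (hV hx), by simpa [E.left_inv x (hV hx)] using hx⟩
  · rintro ⟨hy, hx⟩
    exact ⟨_, hx, E.right_inv y hy⟩

theorem measurableSet_image {V : Set X} (hV : V ⊆ E.A) (hVm : MeasurableSet V) :
    MeasurableSet (E.toFun '' V) := by
  rw [E.image_eq hV]
  exact E.measB.inter (E.meas_invFun hVm)

theorem invFun_image_eq {W : Set Y} (hW : W ⊆ E.B) :
    E.invFun '' W = E.A ∩ E.toFun ⁻¹' W := by
  ext x
  constructor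
  · rintro ⟨y, hy, rfl⟩
    exact ⟨E.mapsTo_inv (hW hy), by simpa [E.right_inv y (hW hy)] using hy⟩
  · rintro ⟨hx, hy⟩
    exact ⟨_, hy, E.left_inv x hx⟩

variable [IsProbabilityMeasure μ] [IsProbabilityMeasure ν]

theorem measure_image {V : Set X} (hV : V ⊆ E.A) (hVm : MeasurableSet V) :
    ν (E.toFun '' V) = ν E.B * (μ E.A)⁻¹ * μ V := by
  rw [mul_assoc, E.measure_eq V hV hVm, ← mul_assoc,
    ENNReal.mul_inv_cancel E.B_pos.ne' (measure_ne_top _ _), one_mul]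

theorem scale_ne_zero (E : SOEquiv R μ S ν) : ν E.B * (μ E.A)⁻¹ ≠ 0 :=
  mul_ne_zero E.B_pos.ne' (ENNReal.inv_ne_zero.2 (measure_ne_top _ _))

theorem scale_ne_top (E : SOEquiv R μ S ν) : ν E.B * (μ E.A)⁻¹ ≠ ⊤ :=
  ENNReal.mul_ne_top (measure_ne_top _ _) (ENNReal.inv_ne_top.2 E.A_pos.ne')

theorem measure_image_eq_zero {V : Set X} (hV : V ⊆ E.A) (hVm : MeasurableSet V) :
    ν (E.toFun '' V) = 0 ↔ μ V = 0 := by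
  rw [E.measure_image hV hVm, mul_eq_zero, or_iff_right E.scale_ne_zero]

/-- The inverse of a stable orbit equivalence. -/
def symm : SOEquiv S ν R μ where
  A := E.B
  B := E.A
  toFun := E.invFun
  invFun := E.toFun
  measA := E.measB
  measB := E.measA
  A_sub := E.B_sub
  B_sub := E.A_sub
  A_pos := E.B_pos
  B_pos := E.A_pos
  A_section := E.B_section
  B_section := E.A_section
  meas_toFun := E.meas_invFun
  meas_invFun := E.meas_toFun
  mapsTo := E.mapsTo_inv
  mapsTo_inv := E.mapsTo
  left_inv := E.right_inv
  right_inv := E.left_inv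
  measure_eq := by
    intro W hW hWm
    have hsub : E.invFun '' W ⊆ E.A := fun x hx => by
      rw [E.invFun_image_eq hW] at hx
      exact hx.1
    have hm : MeasurableSet (E.invFun '' W) := by
      rw [E.invFun_image_eq hW]
      exact E.measA.inter (E.meas_toFun hWm)
    rw [E.measure_eq _ hsub hm, Set.image_image]
    congr 2
    ext y
    constructor
    · exact fun hy => ⟨y, hy, E.right_inv y (hW hy)⟩
    · rintro ⟨y', hy', rfl⟩
      simpa [E.right_inv y' (hW hy')] using hy'
  rel_iff := by
    obtain ⟨C, hCm, hC, hrel⟩ := E.rel_iff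
    refine ⟨E.invFun ⁻¹' C, E.meas_invFun hCm, ?_, ?_⟩
    · have : E.B \ E.invFun ⁻¹' C ⊆ E.toFun '' (E.A \ C) := fun y hy =>
        ⟨E.invFun y, ⟨E.mapsTo_inv hy.1, hy.2⟩, E.right_inv y hy.1⟩
      exact measure_mono_null this
        ((E.measure_image_eq_zero Set.sdiff_subset (E.measA.diff hCm)).2 hC)
    · intro y hy y' hy'
      rw [hrel _ ⟨E.mapsTo_inv hy.1, hy.2⟩ _ ⟨E.mapsTo_inv hy'.1, hy'.2⟩,
        E.right_inv y hy.1, E.right_inv y' hy'.1]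

variable {G H : Type} [Group G] [Group H] (α : PMPAction G X μ) (β : PMPAction H Y ν)
  {I J : Type} (Γ : I → Subgroup G)

/-- An invariant conull set on which a stable orbit equivalence between free actions behaves
well. -/
structure IsCore (X₀ : Set X) : Prop where
  meas : MeasurableSet X₀
  conull : μ X₀ᶜ = 0
  inv : ∀ g, ∀ x ∈ X₀, α.act g x ∈ X₀
  free : ∀ x ∈ X₀, ∀ g, α.act g x = x → g = 1
  rel_iff : ∀ x ∈ X₀ ∩ E.A, ∀ x' ∈ X₀ ∩ E.A, (R.rel x x' ↔ S.rel (E.toFun x) (E.toFun x'))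
  free_image : ∀ x ∈ X₀ ∩ E.A, ∀ h, β.act h (E.toFun x) = E.toFun x → h = 1
  hit : ∀ i, ∀ x ∈ X₀, ∃ g ∈ Γ i, α.act g x ∈ E.A

theorem exists_isCore [StandardBorelSpace X] [StandardBorelSpace Y] [Countable G] [Countable H]
    [Countable I] (hα : α.IsFree) (hβ : β.IsFree) {RΓ : I → CBER X}
    (hRΓ : ∀ i, IsOrbitRel α (Γ i) (RΓ i)) (herg : ∀ i, ErgodicCBER (RΓ i) μ) :
    ∃ X₀, E.IsCore α β Γ X₀ := by
  obtain ⟨C, hCm, hC, hrel⟩ := E.rel_iff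
  let N : Set Y := {y | ∀ h : H, β.act h y = y → h = 1}
  have hNm : MeasurableSet N := β.measurableSet_free
  have hN : ν Nᶜ = 0 := hβ
  let M : Set X := {x | ∀ g : G, α.act g x = x → g = 1}
  have hMm : MeasurableSet M := α.measurableSet_free
  have hM : μ Mᶜ = 0 := hα
  have hANm : MeasurableSet (E.A \ E.toFun ⁻¹' N) := E.measA.diff (E.meas_toFun hNm)
  have hAN : μ (E.A \ E.toFun ⁻¹' N) = 0 := by
    rw [← E.measure_image_eq_zero Set.sdiff_subset hANm]
    refine measure_mono_null ?_ hN
    rintro _ ⟨x, hx, rfl⟩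
    exact hx.2
  let Z : I → Set X := fun i => {x | ∃ g ∈ Γ i, α.act g x ∈ E.A}
  have hZm : ∀ i, MeasurableSet (Z i) := fun i => measurableSet_saturation α (Γ i) E.measA
  have hZ : ∀ i, μ (Z i)ᶜ = 0 := fun i => (herg i).saturation_conull (hRΓ i) E.measA E.A_pos
  obtain ⟨X₀, hsub, hm, hnull, hinv⟩ := α.exists_invariant_conull
    (C := (M ∩ ⋂ i, Z i) ∩ ((E.A \ C)ᶜ ∩ (E.A \ E.toFun ⁻¹' N)ᶜ))
    ((hMm.inter (.iInter hZm)).inter ((E.measA.diff hCm).compl.inter hANm.compl)) (by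
      simp only [Set.compl_inter, Set.compl_iInter, compl_compl]
      exact measure_union_null (measure_union_null hM (measure_iUnion_null hZ))
        (measure_union_null hC hAN))
  have hCX : ∀ x ∈ X₀ ∩ E.A, x ∈ E.A ∩ C := fun x hx =>
    ⟨hx.2, by_contra fun h => (hsub hx.1).2.1 ⟨hx.2, h⟩⟩
  exact ⟨X₀, hm, hnull, hinv, fun x hx => (hsub hx).1.1,
    fun x hx x' hx' => hrel x (hCX x hx) x' (hCX x' hx'),
    fun x hx => by_contra fun h => (hsub hx.1).2.2 ⟨hx.2, h⟩,
    fun i x hx => Set.mem_iInter.1 (hsub hx).1.2 i⟩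

/-- On a set of positive measure, the stable orbit equivalence composed with an element of the
group sends the relation `R'` into `S'`. -/
def Absorbs (R' : CBER X) (S' : CBER Y) : Prop :=
  ∃ V ⊆ E.A, MeasurableSet V ∧ 0 < μ V ∧ ∃ a : H, ∀ x ∈ V, ∀ x' ∈ V, R'.rel x x' →
    S'.rel (β.act a (E.toFun x)) (β.act a (E.toFun x'))

end SOEquiv

theorem exists_separating_seq (X : Type) [MeasurableSpace X] [StandardBorelSpace X] :
    ∃ Q : ℕ → Set X, (∀ n, MeasurableSet (Q n)) ∧ ∀ x y, x ≠ y → ∃ n, x ∈ Q n ∧ y ∉ Q n := by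
  obtain ⟨P, hPm, hP⟩ := exists_seq_separating X (p := MeasurableSet) MeasurableSet.univ Set.univ
  obtain ⟨e⟩ : Nonempty (ℕ ≃ ℕ ⊕ ℕ) := nonempty_equiv_of_countable
  refine ⟨fun n => Sum.elim P (fun n => (P n)ᶜ) (e n), fun n => ?_, fun x y hxy => ?_⟩
  · show MeasurableSet (Sum.elim P (fun n => (P n)ᶜ) (e n))
    rcases e n with m | m
    · exact hPm m
    · exact (hPm m).compl
  · by_contra! hcon
    refine hxy (hP x trivial y trivial fun n => ⟨fun hx => ?_, fun hy => ?_⟩)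
    · simpa using hcon (e.symm (.inl n)) (by simpa using hx)
    · by_contra hx
      exact (by simpa using hcon (e.symm (.inr n)) (by simpa using hx) : y ∉ P n) hy

theorem SOEquiv.exists_absorbs {X Y G H I J : Type} [MeasurableSpace X] [MeasurableSpace Y]
    [StandardBorelSpace X] [StandardBorelSpace Y] [Group G] [Group H] [Countable G] [Countable H]
    [Countable J] [Nonempty J] {R : CBER X} {S : CBER Y} {μ : Measure X} {ν : Measure Y}
    [IsProbabilityMeasure μ] [IsProbabilityMeasure ν] {α : PMPAction G X μ}
    {β : PMPAction H Y ν} {Γ : I → Subgroup G} {Λ : J → Subgroup H}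
    (E : SOEquiv R μ S ν) {X₀ : Set X} (hX₀ : E.IsCore α β Γ X₀) (hR : IsOrbitRel α ⊤ R)
    (hS : IsOrbitRel β ⊤ S) (nf : FreeNormalForm Λ) {RΛ : J → CBER Y}
    (hRΛ : ∀ j, IsOrbitRel β (Λ j) (RΛ j)) (hα : α.IsFree) (i : I) [Infinite (Γ i)]
    (hmfi : MFI (Γ i)) {RΓ : CBER X} (hRΓ : IsOrbitRel α (Γ i) RΓ) :
    ∃ j, E.Absorbs β RΓ (RΛ j) := by
  obtain ⟨Q, hQm, hQ⟩ := exists_separating_seq X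
  obtain ⟨code, hcode⟩ := Countable.exists_injective_nat (Γ i)
  let F : OrbitEmbedding (α.restrict (Γ i)) RΓ β Λ RΛ :=
    { nf := nf
      core := X₀
      sect := X₀ ∩ E.A
      F := E.toFun
      core_meas := hX₀.meas
      sect_meas := hX₀.meas.inter E.measA
      sect_sub := Set.inter_subset_left
      F_meas := E.meas_toFun
      core_inv := fun γ x hx => hX₀.inv γ x hx
      orbS := hRΓ.restrict
      orbΛ := hRΛ
      hit := fun x hx => by
        obtain ⟨g, hg, hgx⟩ := hX₀.hit i x hx
        exact ⟨⟨g, hg⟩, hX₀.inv g x hx, hgx⟩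
      inj := fun x hx y hy h => by rw [← E.left_inv x hx.2, ← E.left_inv y hy.2, h]
      equivar := fun x hx y hy h => by
        obtain ⟨g, -, hg⟩ := (hRΓ.2 _ _).1 h
        obtain ⟨h, -, hh⟩ := (hS.2 _ _).1
          ((hX₀.rel_iff x hx y hy).1 ((hR.2 _ _).2 ⟨g, trivial, hg⟩))
        exact ⟨h, hh⟩
      free := hX₀.free_image
      code := code
      code_inj := hcode
      Q := Q
      Q_meas := hQm
      Q_sep := hQ }
  obtain ⟨V, hV, hVm, hpos, j, a, h⟩ := F.exists_main hX₀.conull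
    (fun x hx γ hγ => Subtype.ext (hX₀.free x hx γ hγ))
    (hmfi X μ (α.restrict (Γ i)) RΓ (hα.restrict _) hRΓ.restrict)
  exact ⟨j, V, hV.trans Set.inter_subset_right, hVm, hpos, a, h⟩

theorem SOEquiv.soe_of_absorbs {X Y G H I : Type} [MeasurableSpace X] [MeasurableSpace Y]
    [StandardBorelSpace X] [Group G] [Group H] [Countable G] [Countable H]
    {R : CBER X} {S : CBER Y} {μ : Measure X} {ν : Measure Y}
    [IsProbabilityMeasure μ] [IsProbabilityMeasure ν] {α : PMPAction G X μ}
    {β : PMPAction H Y ν} {Γ : I → Subgroup G} {Λ : Subgroup H}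
    (E : SOEquiv R μ S ν) {X₀ : Set X} (hX₀ : E.IsCore α β Γ X₀) (hR : IsOrbitRel α ⊤ R)
    (hS : IsOrbitRel β ⊤ S) (nf : FreeNormalForm Γ) {RΓ : I → CBER X} {RΛ : CBER Y}
    (hRΓ : ∀ i, IsOrbitRel α (Γ i) (RΓ i)) (hRΛ : IsOrbitRel β Λ RΛ)
    {i i' : I} [Infinite (Γ i)] (hergΓ : ErgodicCBER (RΓ i) μ) (hergΛ : ErgodicCBER RΛ ν)
    (h : E.Absorbs β (RΓ i) RΛ) (h' : E.symm.Absorbs α RΛ (RΓ i')) :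
    i = i' ∧ SOE (RΓ i) μ RΛ ν := by
  obtain ⟨V₀, hV₀A, hV₀m, hV₀pos, a₀, hV₀⟩ := h
  obtain ⟨W₀, hW₀B, hW₀m, hW₀pos, g, hW₀⟩ := h'
  replace hW₀B : W₀ ⊆ E.B := hW₀B
  replace hW₀ : ∀ y ∈ W₀, ∀ y' ∈ W₀, RΛ.rel y y' →
      (RΓ i').rel (α.act g (E.invFun y)) (α.act g (E.invFun y')) := hW₀
  -- restrict to the core
  obtain ⟨V, hVsub, hVm, hVpos⟩ : ∃ V ⊆ V₀ ∩ X₀, MeasurableSet V ∧ 0 < μ V := by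
    refine ⟨_, subset_rfl, hV₀m.inter hX₀.meas, ?_⟩
    rw [measure_inter_conull hX₀.conull]
    exact hV₀pos
  have hVA : V ⊆ E.A := fun x hx => hV₀A (hVsub hx).1
  obtain ⟨W, hWsub, hWX, hWm, hWpos⟩ :
      ∃ W ⊆ W₀, (∀ y ∈ W, E.invFun y ∈ X₀) ∧ MeasurableSet W ∧ 0 < ν W := by
    refine ⟨W₀ ∩ E.invFun ⁻¹' X₀, Set.inter_subset_left, fun y hy => hy.2,
      hW₀m.inter (E.meas_invFun hX₀.meas), ?_⟩
    rw [pos_iff_ne_zero] at hW₀pos ⊢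
    contrapose! hW₀pos
    have hnull : ν (E.toFun '' (E.A \ X₀)) = 0 :=
      (E.measure_image_eq_zero Set.sdiff_subset (E.measA.diff hX₀.meas)).2
        (measure_mono_null (fun x hx => hx.2) hX₀.conull)
    refine measure_mono_null (fun y hy => ?_) (measure_union_null hW₀pos hnull)
    by_cases hyX : E.invFun y ∈ X₀
    · exact Or.inl ⟨hy, hyX⟩
    · exact Or.inr ⟨_, ⟨E.mapsTo_inv (hW₀B hy), hyX⟩, E.right_inv y (hW₀B hy)⟩
  have hWB : W ⊆ E.B := hWsub.trans hW₀B
  -- move the image of a piece of `V` into `W`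
  obtain ⟨l, hl, V₁, hV₁V, hV₁m, hV₁pos, hV₁W⟩ : ∃ l ∈ Λ, ∃ V₁ ⊆ V, MeasurableSet V₁ ∧ 0 < μ V₁ ∧
      ∀ x ∈ V₁, β.act (l * a₀) (E.toFun x) ∈ W := by
    have hm : ∀ l, MeasurableSet (V ∩ (fun x => β.act (l * a₀) (E.toFun x)) ⁻¹' W) := fun l =>
      hVm.inter (((β.measurable_act _).comp E.meas_toFun) hWm)
    by_contra! hcon
    have hnull : ∀ l ∈ Λ, μ (V ∩ (fun x => β.act (l * a₀) (E.toFun x)) ⁻¹' W) = 0 := by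
      intro l hl
      by_contra h0
      obtain ⟨x, hx, hxW⟩ := hcon l hl _ Set.inter_subset_left (hm l) (pos_iff_ne_zero.2 h0)
      exact hxW hx.2
    have hsat := hergΛ.saturation_conull hRΛ hWm hWpos
    have hbad : ν (β.act a₀ ⁻¹' {y | ∃ k ∈ Λ, β.act k y ∈ W}ᶜ) = 0 := by
      rw [β.measure_preimage _ (measurableSet_saturation β Λ hWm).compl, hsat]
    have h1 : ν (E.toFun '' V) = 0 := by
      refine measure_mono_null (t := β.act a₀ ⁻¹' {y | ∃ k ∈ Λ, β.act k y ∈ W}ᶜ ∪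
        ⋃ l ∈ Λ, E.toFun '' (V ∩ (fun x => β.act (l * a₀) (E.toFun x)) ⁻¹' W)) ?_
        (measure_union_null hbad (measure_iUnion_null fun l => measure_iUnion_null fun hl =>
          (E.measure_image_eq_zero (Set.inter_subset_left.trans hVA) (hm l)).2 (hnull l hl)))
      rintro _ ⟨x, hx, rfl⟩
      by_cases hxs : ∃ k ∈ Λ, β.act k (β.act a₀ (E.toFun x)) ∈ W
      · obtain ⟨k, hk, hkx⟩ := hxs
        refine Or.inr (Set.mem_iUnion₂.2 ⟨k, hk, x, ⟨hx, ?_⟩, rfl⟩)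
        show β.act (k * a₀) (E.toFun x) ∈ W
        rwa [β.act_mul]
      · exact Or.inl hxs
    exact hVpos.ne' ((E.measure_image_eq_zero hVA hVm).1 h1)
  set a := l * a₀ with ha
  have hV₁rel : ∀ x ∈ V₁, ∀ x' ∈ V₁, (RΓ i).rel x x' →
      RΛ.rel (β.act a (E.toFun x)) (β.act a (E.toFun x')) := by
    intro x hx x' hx' hxx
    rw [ha, β.act_mul, β.act_mul]
    have hact : ∀ y, RΛ.rel y (β.act l y) := fun y => (hRΛ.2 _ _).2 ⟨l, hl, rfl⟩
    exact RΛ.trans (RΛ.symm (hact _)) (RΛ.trans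
      (hV₀ x (hVsub (hV₁V hx)).1 x' (hVsub (hV₁V hx')).1 hxx) (hact _))
  have hV₁A : V₁ ⊆ E.A := hV₁V.trans hVA
  have hV₁X : V₁ ⊆ X₀ := fun x hx => (hVsub (hV₁V hx)).2
  -- make the return cocycle constant
  obtain ⟨u, V₂, hV₂V, hV₂m, hV₂pos, hV₂u⟩ : ∃ u : G, ∃ V₂ ⊆ V₁, MeasurableSet V₂ ∧ 0 < μ V₂ ∧
      ∀ x ∈ V₂, E.invFun (β.act a (E.toFun x)) = α.act u x := by
    have hm : ∀ u, MeasurableSet (V₁ ∩ {x | E.invFun (β.act a (E.toFun x)) = α.act u x}) :=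
      fun u => hV₁m.inter (measurableSet_eq_fun
        (E.meas_invFun.comp ((β.measurable_act _).comp E.meas_toFun)) (α.measurable_act u))
    by_contra! hcon
    refine hV₁pos.ne' (measure_mono_null (t := ⋃ u,
      (V₁ ∩ {x | E.invFun (β.act a (E.toFun x)) = α.act u x})) ?_
      (measure_iUnion_null fun u => ?_))
    · intro x hx
      have hy := hV₁W x hx
      have hrel : R.rel x (E.invFun (β.act a (E.toFun x))) := by
        rw [hX₀.rel_iff x ⟨hV₁X hx, hV₁A hx⟩ _ ⟨hWX _ hy, E.mapsTo_inv (hWB hy)⟩,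
          E.right_inv _ (hWB hy)]
        exact (hS.2 _ _).2 ⟨a, trivial, rfl⟩
      obtain ⟨u, -, hu⟩ := (hR.2 _ _).1 hrel
      exact Set.mem_iUnion.2 ⟨u, hx, hu.symm⟩
    · by_contra h0
      obtain ⟨x, hx, hxu⟩ := hcon u _ Set.inter_subset_left (hm u) (pos_iff_ne_zero.2 h0)
      exact hxu hx.2
  have hback : ∀ x ∈ V₂, ∀ x' ∈ V₂, RΛ.rel (β.act a (E.toFun x)) (β.act a (E.toFun x')) →
      (RΓ i').rel (α.act (g * u) x) (α.act (g * u) x') := by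
    intro x hx x' hx' hrel
    have := hW₀ _ (hWsub (hV₁W x (hV₂V hx))) _ (hWsub (hV₁W x' (hV₂V hx'))) hrel
    rwa [hV₂u x hx, hV₂u x' hx', ← α.act_mul, ← α.act_mul] at this
  obtain ⟨rfl, hgu⟩ : i = i' ∧ g * u ∈ Γ i := by
    obtain ⟨x, hx, k, -, hk1, -, -, hkx, -⟩ := (α.restrict (Γ i)).exists_recurrence hV₂m hV₂pos
    replace hkx : α.act k x ∈ V₂ := hkx
    have hxk : (RΓ i).rel x (α.act k x) := ((hRΓ i).2 _ _).2 ⟨k, k.2, rfl⟩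
    obtain ⟨h, hh, he⟩ := ((hRΓ i').2 _ _).1
      (hback x hx _ hkx (hV₁rel x (hV₂V hx) _ (hV₂V hkx) hxk))
    rw [← α.act_mul, ← α.act_mul] at he
    have h1 : h * (g * u) = g * u * k := by
      refine inv_mul_eq_one.1 (hX₀.free x (hV₁X (hV₂V hx)) _ ?_)
      rw [α.act_mul, ← he, α.inv_act_act]
    refine nf.malnormal k.2 (fun h => hk1 (Subtype.ext h)) ?_
    rw [← h1]
    simpa [mul_assoc] using hh
  refine ⟨rfl, ⟨?_⟩⟩
  have hV₂A : V₂ ⊆ E.A := hV₂V.trans hV₁A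
  have himg : ∀ {D : Set X}, (fun x => β.act a (E.toFun x)) '' D =
      β.act a⁻¹ ⁻¹' (E.toFun '' D) := by
    intro D
    ext y
    constructor
    · rintro ⟨x, hx, rfl⟩
      exact ⟨x, hx, (β.inv_act_act _ _).symm⟩
    · rintro ⟨x, hx, hxy⟩
      exact ⟨x, hx, by simp [hxy]⟩
  have hmeas : ∀ {D : Set X}, D ⊆ E.A → MeasurableSet D →
      ν ((fun x => β.act a (E.toFun x)) '' D) = ν E.B * (μ E.A)⁻¹ * μ D := by
    intro D hD hDm
    rw [himg, β.measure_preimage _ (E.measurableSet_image hD hDm), E.measure_image hD hDm]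
  have hBm : MeasurableSet ((fun x => β.act a (E.toFun x)) '' V₂) := by
    rw [himg]
    exact β.measurable_act _ (E.measurableSet_image hV₂A hV₂m)
  have hBpos : 0 < ν ((fun x => β.act a (E.toFun x)) '' V₂) := by
    rw [hmeas hV₂A hV₂m]
    exact pos_iff_ne_zero.2 (mul_ne_zero E.scale_ne_zero hV₂pos.ne')
  exact
    { A := V₂
      B := (fun x => β.act a (E.toFun x)) '' V₂
      toFun := fun x => β.act a (E.toFun x)
      invFun := fun y => E.invFun (β.act a⁻¹ y)
      measA := hV₂m
      measB := hBm
      A_sub := fun x _ => by rw [(hRΓ i).1]; trivial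
      B_sub := fun y _ => by rw [hRΛ.1]; trivial
      A_pos := hV₂pos
      B_pos := hBpos
      A_section := by
        have hsat : ∀ᵐ x ∂μ, ∃ k ∈ Γ i, α.act k x ∈ V₂ :=
          hergΓ.saturation_conull (hRΓ i) hV₂m hV₂pos
        filter_upwards [hsat] with x hx _
        obtain ⟨k, hk, hkx⟩ := hx
        exact ⟨_, hkx, ((hRΓ i).2 _ _).2 ⟨k, hk, rfl⟩⟩
      B_section := by
        have hsat : ∀ᵐ y ∂ν, ∃ k ∈ Λ, β.act k y ∈ (fun x => β.act a (E.toFun x)) '' V₂ :=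
          hergΛ.saturation_conull hRΛ hBm hBpos
        filter_upwards [hsat] with y hy _
        obtain ⟨k, hk, hky⟩ := hy
        exact ⟨_, hky, (hRΛ.2 _ _).2 ⟨k, hk, rfl⟩⟩
      meas_toFun := (β.measurable_act _).comp E.meas_toFun
      meas_invFun := E.meas_invFun.comp (β.measurable_act _)
      mapsTo := fun x hx => ⟨x, hx, rfl⟩
      mapsTo_inv := by
        rintro _ ⟨x, hx, rfl⟩
        simpa [E.left_inv x (hV₂A hx)] using hx
      left_inv := fun x hx => by simp [E.left_inv x (hV₂A hx)]
      right_inv := by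
        rintro _ ⟨x, hx, rfl⟩
        simp [E.left_inv x (hV₂A hx)]
      measure_eq := by
        intro D hD hDm
        rw [hmeas hV₂A hV₂m, hmeas (hD.trans hV₂A) hDm,
          ENNReal.mul_inv (Or.inl E.scale_ne_zero) (Or.inl E.scale_ne_top), mul_mul_mul_comm,
          ENNReal.inv_mul_cancel E.scale_ne_zero E.scale_ne_top, one_mul]
      rel_iff := by
        refine ⟨V₂, hV₂m, by simp, fun x hx x' hx' =>
          ⟨hV₁rel x (hV₂V hx.1) x' (hV₂V hx'.1), fun hrel => ?_⟩⟩
        have hact : ∀ z, (RΓ i).rel z (α.act (g * u) z) := fun z =>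
          ((hRΓ i).2 _ _).2 ⟨_, hgu, rfl⟩
        exact (RΓ i).trans (hact x)
          ((RΓ i).trans (hback x hx.1 x' hx'.1 hrel) ((RΓ i).symm (hact x'))) }

/-- SOE rigidity for free products of MFI groups with ergodic restrictions. -/
theorem free_products_MFI_ergodic_SOE_rigidity
    {X Y : Type} [MeasurableSpace X] [StandardBorelSpace X]
    [MeasurableSpace Y] [StandardBorelSpace Y]
    (μ : MeasureTheory.Measure X) [MeasureTheory.IsProbabilityMeasure μ]
    (ν : MeasureTheory.Measure Y) [MeasureTheory.IsProbabilityMeasure ν]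
    {G H : Type} [Group G] [Countable G] [Group H] [Countable H]
    {I J : Type} [Nonempty I] [Countable I] [Nonempty J] [Countable J]
    (Γ : I → Subgroup G) (Λ : J → Subgroup H)
    (hG : IsFreeProductOf G Γ) (hH : IsFreeProductOf H Λ)
    (hΓinf : ∀ i, Infinite (Γ i)) (hΛinf : ∀ j, Infinite (Λ j))
    (hΓmfi : ∀ i, MFI (Γ i)) (hΛmfi : ∀ j, MFI (Λ j))
    (α : PMPAction G X μ) (β : PMPAction H Y ν)
    (hαfree : α.IsFree) (hβfree : β.IsFree)
    (Rα : CBER X) (Rβ : CBER Y)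
    (hRα : IsOrbitRel α ⊤ Rα) (hRβ : IsOrbitRel β ⊤ Rβ)
    (RΓ : I → CBER X) (RΛ : J → CBER Y)
    (hRΓ : ∀ i, IsOrbitRel α (Γ i) (RΓ i)) (hRΛ : ∀ j, IsOrbitRel β (Λ j) (RΛ j))
    (hergΓ : ∀ i, ErgodicCBER (RΓ i) μ) (hergΛ : ∀ j, ErgodicCBER (RΛ j) ν)
    (hsoe : SOE Rα μ Rβ ν) :
    ∃ θ : I ≃ J, ∀ i, SOE (RΓ i) μ (RΛ (θ i)) ν := by
  obtain ⟨E⟩ := hsoe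
  obtain ⟨nfG⟩ := hG.nonempty_normalForm
  obtain ⟨nfH⟩ := hH.nonempty_normalForm
  obtain ⟨X₀, hX₀⟩ := E.exists_isCore α β Γ hαfree hβfree hRΓ hergΓ
  obtain ⟨Y₀, hY₀⟩ := E.symm.exists_isCore β α Λ hβfree hαfree hRΛ hergΛ
  choose θ hθ using fun i => E.exists_absorbs hX₀ hRα hRβ nfH hRΛ hαfree i (hΓmfi i) (hRΓ i)
  choose θ' hθ' using fun j =>
    E.symm.exists_absorbs hY₀ hRβ hRα nfG hRΓ hβfree j (hΛmfi j) (hRΛ j)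
  have hleft := fun i => E.soe_of_absorbs hX₀ hRα hRβ nfG hRΓ (hRΛ (θ i)) (hergΓ i)
    (hergΛ (θ i)) (hθ i) (hθ' (θ i))
  have hright := fun j => E.symm.soe_of_absorbs hY₀ hRβ hRα nfH hRΛ (hRΓ (θ' j)) (hergΛ j)
    (hergΓ (θ' j)) (hθ' j) (hθ (θ' j))
  exact ⟨⟨θ, θ', fun i => (hleft i).1.symm, fun j => (hright j).1.symm⟩, fun i => (hleft i).2⟩
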